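/- Let g be a finite-dimensional simple Lie algebra over ℂ, let n and m be positive integers, and let V_1, …, V_n and W_1, …, W_m be nontrivial finite-dimensional irreducible g-modules such that V_1 ⊗ V_2 ⊗ ⋯ ⊗ V_n ≅ W_1 ⊗ W_2 ⊗ ⋯ ⊗ W_m as g-modules. Then n = m and there is a permutation σ of {1, …, n} such that V_i ≅ W_{σ(i)} as g-modules for all 1 ≤ i ≤ n. -/

import Mathlib

open scoped TensorProduct

/-- A bundled Lie module over the Lie algebra `L` (over `ℂ`). -/
structure LieModuleObj (L : Type*) [LieRing L] [LieAlgebra ℂ L] where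
  carrier : Type
  [isAddCommGroup : AddCommGroup carrier]
  [isModule : Module ℂ carrier]
  [isLieRingModule : LieRingModule L carrier]
  [isLieModule : LieModule ℂ L carrier]

attribute [instance] LieModuleObj.isAddCommGroup LieModuleObj.isModule
  LieModuleObj.isLieRingModule LieModuleObj.isLieModule

variable {L : Type*} [LieRing L] [LieAlgebra ℂ L]

/-- The trivial one-dimensional module `ℂ` (serving as the empty tensor product). -/
noncomputable def LieModuleObj.unit (L : Type*) [LieRing L] [LieAlgebra ℂ L] :
    LieModuleObj L :=
  letI inst : LieRingModule L ℂ :=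
    { bracket := fun _ _ => 0
      add_lie := by simp
      lie_add := by simp
      leibniz_lie := by simp }
  { carrier := ℂ
    isLieRingModule := inst
    isLieModule :=
      { smul_lie := fun c x m => by show (0 : ℂ) = c • (0 : ℂ); simp
        lie_smul := fun c x m => by show (0 : ℂ) = c • (0 : ℂ); simp } }

/-- The tensor product (over `ℂ`) of two bundled Lie modules, with the usual action
`x·(v ⊗ w) = (x·v) ⊗ w + v ⊗ (x·w)`. -/
noncomputable def LieModuleObj.tensor (M N : LieModuleObj L) : LieModuleObj L where
  carrier := M.carrier ⊗[ℂ] N.carrier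

/-- The iterated tensor product `V 0 ⊗ V 1 ⊗ ⋯ ⊗ V (n-1)` of a family of bundled Lie
modules. -/
noncomputable def LieModuleObj.tensorAll :
    (n : ℕ) → (Fin n → LieModuleObj L) → LieModuleObj L
  | 0, _ => LieModuleObj.unit L
  | n + 1, V => (LieModuleObj.tensorAll n fun i => V i.castSucc).tensor (V (Fin.last n))


set_option linter.unusedSectionVars false

namespace UFT

section Comb
variable {ι : Type*} [DecidableEq ι]

open Classical in
/-- signed indicator of independent sets -/
noncomputable def uInd (adj : ι → ι → Prop) (I : Finset ι) : ℂ :=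
  if (∀ x ∈ I, ∀ y ∈ I, ¬ adj x y) then (-1) ^ I.card else 0

/-- auxiliary sums counting heaps -/
noncomputable def rSum (adj : ι → ι → Prop) (w : Finset ι → ℂ) (A B : Finset ι) : ℂ :=
  ∑ I ∈ (B \ A).powerset, uInd adj I * w (B \ I)

/-- Every part of `B` is connected to `A` inside `B`. -/
def Conn (adj : ι → ι → Prop) (A B : Finset ι) : Prop :=
  ∀ C ⊆ B, C.Nonempty → Disjoint C A → ∃ c ∈ C, ∃ d ∈ B \ C, adj c d

open Classical in
lemma rSum_insert [Fintype ι] (adj : ι → ι → Prop) (hs : ∀ x y, adj x y → adj y x)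
    (hi : ∀ x, ¬ adj x x) (w : Finset ι → ℂ) (A B : Finset ι) (a : ι) (ha : a ∉ A) (hb : a ∈ B) :
    rSum adj w (insert a A) B = rSum adj w A B +
      rSum adj w (A ∪ Finset.univ.filter (fun x => adj a x)) (B.erase a) := by
  unfold rSum
  have h1 : B \ A = insert a (B \ insert a A) := by
    ext x; by_cases hx : x = a
    · subst hx; simp [ha, hb]
    · simp [hx]
  rw [h1, Finset.sum_powerset_insert (by simp)]
  have h2 : ∑ t ∈ (B \ insert a A).powerset, uInd adj (insert a t) * w (B \ insert a t)
      = - ∑ I ∈ (B.erase a \ (A ∪ Finset.univ.filter (fun x => adj a x))).powerset,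
        uInd adj I * w (B.erase a \ I) := by
    rw [← Finset.sum_neg_distrib]
    symm
    have hsub : (B.erase a \ (A ∪ Finset.univ.filter (fun x => adj a x))).powerset ⊆
        (B \ insert a A).powerset := by
      apply Finset.powerset_mono.2
      intro x; simp; tauto
    rw [← Finset.sum_subset hsub]
    · apply Finset.sum_congr rfl
      intro I hI
      rw [Finset.mem_powerset] at hI
      have haI : a ∉ I := fun h => by simpa using hI h
      have hn : ∀ x ∈ I, ¬ adj a x := fun x hx => by
        have := hI hx; simp at this; tauto
      have : uInd adj (insert a I) = - uInd adj I := by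
        unfold uInd
        have e : (∀ x ∈ insert a I, ∀ y ∈ insert a I, ¬ adj x y) ↔ (∀ x ∈ I, ∀ y ∈ I, ¬ adj x y) := by
          constructor
          · intro h x hx y hy; exact h x (by simp [hx]) y (by simp [hy])
          · intro h x hx y hy
            rw [Finset.mem_insert] at hx hy
            rcases hx with rfl | hx <;> rcases hy with rfl | hy
            · exact hi _
            · exact hn _ hy
            · exact fun h' => hn _ hx (hs _ _ h')
            · exact h x hx y hy
        by_cases hI2 : (∀ x ∈ I, ∀ y ∈ I, ¬ adj x y)
        · rw [if_pos hI2, if_pos (e.2 hI2), Finset.card_insert_of_notMem haI]; ring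
        · rw [if_neg hI2, if_neg (fun h => hI2 (e.1 h))]; ring
      rw [this]
      have : B \ insert a I = B.erase a \ I := by
        ext x; simp; tauto
      rw [this]; ring
    · intro I hI hI'
      rw [Finset.mem_powerset] at hI hI'
      have : ∃ x ∈ I, adj a x := by
        by_contra! hc
        apply hI'
        intro x hx
        have := hI hx
        simp at this ⊢
        exact ⟨⟨fun h => this.2.1 h, this.1⟩, this.2.2, hc x hx⟩
      obtain ⟨x, hx, hax⟩ := this
      have : uInd adj (insert a I) = 0 := by
        unfold uInd
        rw [if_neg]
        intro h
        exact h a (by simp) x (by simp [hx]) hax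
      rw [this]; ring
  rw [h2]; ring

lemma rSum_nat [Fintype ι] (adj : ι → ι → Prop) (hs : ∀ x y, adj x y → adj y x)
    (hi : ∀ x, ¬ adj x x) (w : Finset ι → ℂ) (hw0 : w ∅ = 1)
    (hw : ∀ B : Finset ι, B.Nonempty → ∑ I ∈ B.powerset, uInd adj I * w (B \ I) = 0) :
    ∀ (n : ℕ) (B A : Finset ι), B.card = n →
      ∃ n : ℕ, rSum adj w A B = n ∧ (Conn adj A B → 0 < n) := by
  classical
  intro n
  induction n using Nat.strong_induction_on with
  | _ n ih =>
  intro B A hB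
  induction A using Finset.induction_on with
  | empty =>
    rcases B.eq_empty_or_nonempty with rfl | hne
    · exact ⟨1, by simp [rSum, uInd, hw0], fun _ => one_pos⟩
    · refine ⟨0, ?_, ?_⟩
      · unfold rSum; rw [Finset.sdiff_empty]; simpa using hw B hne
      · intro hc
        obtain ⟨c, hc, d, hd, _⟩ := hc B subset_rfl hne (by simp)
        simp at hd
  | insert a A ha ihA =>
    by_cases hb : a ∈ B
    · rw [rSum_insert adj hs hi w A B a ha hb]
      obtain ⟨n1, h1, -⟩ := ihA
      obtain ⟨n2, h2, h2'⟩ := ih (B.erase a).card (by rw [← hB]; exact Finset.card_erase_lt_of_mem hb)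
        (B.erase a) (A ∪ Finset.univ.filter (fun x => adj a x)) rfl
      refine ⟨n1 + n2, by rw [h1, h2]; push_cast; ring, fun hc => ?_⟩
      have := h2' ?_
      · omega
      intro C hC hne hdisj
      rw [Finset.disjoint_left] at hdisj
      obtain ⟨c, hcC, d, hd, hcd⟩ := hc C (hC.trans (Finset.erase_subset _ _)) hne (by
        rw [Finset.disjoint_left]
        intro x hx hx'
        rw [Finset.mem_insert] at hx'
        rcases hx' with rfl | hx'
        · simpa using hC hx
        · exact hdisj hx (by simp [hx']))
      refine ⟨c, hcC, d, ?_, hcd⟩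
      have hda : d ≠ a := by
        rintro rfl
        exact hdisj hcC (by simp [hs _ _ hcd])
      simp at hd ⊢
      exact ⟨⟨hda, hd.1⟩, hd.2⟩
    · have e : B \ insert a A = B \ A := by
        ext x; simp; rintro hx hxa rfl; exact hb hx
      obtain ⟨n, h1, h2⟩ := ihA
      refine ⟨n, by rw [← h1]; unfold rSum; rw [e], fun hc => h2 ?_⟩
      intro C hC hne hd
      refine hc C hC hne ?_
      rw [Finset.disjoint_insert_right]
      exact ⟨fun h => hb (hC h), hd⟩

end Comb

section PS
variable {ι : Type*} [Fintype ι] [DecidableEq ι]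

open MvPowerSeries

/-- Exponent vector `k` restricted to the set `B`. -/
noncomputable def kk (k : ι →₀ ℕ) (B : Finset ι) : ι →₀ ℕ :=
  Finsupp.equivFunOnFinite.symm (fun i => if i ∈ B then k i else 0)

lemma kk_apply (k : ι →₀ ℕ) (B : Finset ι) (i : ι) : kk k B i = if i ∈ B then k i else 0 := rfl

/-- allowed exponents -/
def Allow (k b : ι →₀ ℕ) : Prop := ∀ i, b i = 0 ∨ k i ≤ b i

/-- The shape of the normalized numerators in the character formula. -/
structure Good (adj : ι → ι → Prop) (k : ι →₀ ℕ) (P : MvPowerSeries ι ℂ) : Prop where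
  pos : ∀ i, 0 < k i
  supp : ∀ b, coeff b P ≠ 0 → Allow k b
  low : ∀ I : Finset ι, coeff (kk k I) P = uInd adj I

lemma Good.const {adj : ι → ι → Prop} {k : ι →₀ ℕ} {P : MvPowerSeries ι ℂ} (h : Good adj k P) :
    constantCoeff P = 1 := by
  have := h.low ∅
  have e : kk k ∅ = 0 := by ext i; simp [kk_apply]
  rw [e] at this
  simpa [uInd] using this

lemma Allow.add {k a b : ι →₀ ℕ} (ha : Allow k a) (hb : Allow k b) : Allow k (a + b) := by
  intro i
  have := ha i; have := hb i
  simp only [Finsupp.add_apply]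
  omega

lemma inv_supp {k : ι →₀ ℕ} {P : MvPowerSeries ι ℂ} (hc : constantCoeff P = 1)
    (h : ∀ b, coeff b P ≠ 0 → Allow k b) : ∀ b, coeff b P⁻¹ ≠ 0 → Allow k b := by
  have key : ∀ n : ℕ, ∀ b : ι →₀ ℕ, b.degree = n → coeff b P⁻¹ ≠ 0 → Allow k b := by
    intro n
    induction n using Nat.strong_induction_on with
    | _ n ih =>
    intro b hb hne
    by_contra hA
    have hb0 : b ≠ 0 := by rintro rfl; exact hA (fun i => Or.inl rfl)
    have h1 : coeff b (P * P⁻¹) = 0 := by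
      rw [MvPowerSeries.mul_inv_cancel _ (by rw [hc]; exact one_ne_zero), coeff_one, if_neg hb0]
    rw [coeff_mul, Finset.sum_eq_single (0, b)] at h1
    · simp [hc] at h1; exact hne h1
    · rintro ⟨x, y⟩ hxy hne'
      by_contra hp
      rw [Finset.HasAntidiagonal.mem_antidiagonal] at hxy
      simp only at hxy hp
      have hx0 : x ≠ 0 := by rintro rfl; apply hne'; simp at hxy; simp [hxy]
      apply hA
      rw [← hxy]
      refine (h x (left_ne_zero_of_mul hp)).add (ih y.degree ?_ y rfl (right_ne_zero_of_mul hp))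
      rw [← hb, ← hxy, map_add]
      have : x.degree ≠ 0 := by rwa [Ne, Finsupp.degree_eq_zero_iff]
      omega
    · intro h; simp at h
  exact fun b => key _ b rfl

lemma sum_kk {k : ι →₀ ℕ} (hk : ∀ i, 0 < k i) (B : Finset ι) (f : (ι →₀ ℕ) → (ι →₀ ℕ) → ℂ)
    (hf : ∀ a b, f a b ≠ 0 → Allow k a ∧ Allow k b) :
    ∑ p ∈ Finset.HasAntidiagonal.antidiagonal (kk k B), f p.1 p.2 =
      ∑ I ∈ B.powerset, f (kk k I) (kk k (B \ I)) := by
  symm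
  refine Finset.sum_bij_ne_zero (fun I _ _ => (kk k I, kk k (B \ I))) ?_ ?_ ?_ ?_
  · intro I hI _
    rw [Finset.mem_powerset] at hI
    rw [Finset.HasAntidiagonal.mem_antidiagonal]
    ext i
    simp only [Finsupp.add_apply, kk_apply, Finset.mem_sdiff]
    by_cases h1 : i ∈ I
    · simp [h1, hI h1]
    · simp [h1]
  · intro I _ _ J _ _ h
    have h1 := congrArg Prod.fst h
    ext i
    have := DFunLike.congr_fun h1 i
    simp only [kk_apply] at this
    have := hk i
    split_ifs at * <;> simp_all
  · rintro ⟨a, b⟩ hab hne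
    rw [Finset.HasAntidiagonal.mem_antidiagonal] at hab
    simp only at hab hne
    obtain ⟨ha, hb⟩ := hf a b hne
    have hab' : ∀ i, a i + b i = if i ∈ B then k i else 0 := fun i => by
      rw [← kk_apply, ← hab]; rfl
    have ea : a = kk k (B.filter (fun i => a i ≠ 0)) := by
      ext i
      have h1 := hab' i; have h2 : a i = 0 ∨ k i ≤ a i := ha i
      simp only [kk_apply, Finset.mem_filter]
      by_cases hB : i ∈ B <;> by_cases h0 : a i = 0 <;> simp [hB, h0] at h1 ⊢ <;> omega
    have eb : b = kk k (B \ (B.filter (fun i => a i ≠ 0))) := by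
      ext i
      have h1 := hab' i; have h2 : a i = 0 ∨ k i ≤ a i := ha i
      simp only [kk_apply, Finset.mem_filter, Finset.mem_sdiff]
      by_cases hB : i ∈ B <;> by_cases h0 : a i = 0 <;> simp [hB, h0] at h1 ⊢ <;> omega
    refine ⟨B.filter (fun i => a i ≠ 0), by simp, ?_, ?_⟩
    · rwa [← ea, ← eb]
    · rw [← ea, ← eb]
  · intros; rfl

/-- The Euler derivation in the variable `v`. -/
noncomputable def theta (v : ι) (P : MvPowerSeries ι ℂ) : MvPowerSeries ι ℂ :=
  fun b => (b v : ℂ) * coeff b P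

lemma coeff_theta (v : ι) (P : MvPowerSeries ι ℂ) (b : ι →₀ ℕ) :
    coeff b (theta v P) = (b v : ℂ) * coeff b P := rfl

lemma theta_mul (v : ι) (P Q : MvPowerSeries ι ℂ) :
    theta v (P * Q) = theta v P * Q + P * theta v Q := by
  ext b
  rw [map_add, coeff_theta, coeff_mul, coeff_mul, coeff_mul, Finset.mul_sum,
    ← Finset.sum_add_distrib]
  apply Finset.sum_congr rfl
  rintro ⟨x, y⟩ hxy
  rw [Finset.HasAntidiagonal.mem_antidiagonal] at hxy
  simp only [coeff_theta]
  rw [← hxy]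
  simp; ring

/-- coefficients of the logarithmic derivative -/
noncomputable def dlog (v : ι) (P : MvPowerSeries ι ℂ) : MvPowerSeries ι ℂ := theta v P * P⁻¹

lemma dlog_mul (v : ι) (P Q : MvPowerSeries ι ℂ) (hP : constantCoeff P = 1)
    (hQ : constantCoeff Q = 1) : dlog v (P * Q) = dlog v P + dlog v Q := by
  unfold dlog
  rw [theta_mul, MvPowerSeries.mul_inv_rev]
  have h1 := MvPowerSeries.mul_inv_cancel P (by rw [hP]; exact one_ne_zero)
  have h2 := MvPowerSeries.mul_inv_cancel Q (by rw [hQ]; exact one_ne_zero)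
  linear_combination (theta v P * P⁻¹) * h2 + (theta v Q * Q⁻¹) * h1

lemma dlog_multiset {κ : Type*} (v : ι) (f : κ → MvPowerSeries ι ℂ) (S : Multiset κ)
    (h : ∀ k ∈ S, constantCoeff (f k) = 1) :
    constantCoeff (S.map f).prod = 1 ∧
    dlog v (S.map f).prod = (S.map (fun k => dlog v (f k))).sum := by
  induction S using Multiset.induction_on with
  | empty =>
    refine ⟨by simp, ?_⟩
    have : theta v (1 : MvPowerSeries ι ℂ) = 0 := by
      ext b
      rw [coeff_theta, coeff_one]
      split_ifs with hb
      · simp [hb]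
      · simp
    simp [dlog, this]
  | cons a S ih =>
    obtain ⟨h1, h2⟩ := ih (fun k hk => h k (Multiset.mem_cons_of_mem hk))
    have h3 := h a (Multiset.mem_cons_self a S)
    simp only [Multiset.map_cons, Multiset.prod_cons, Multiset.sum_cons]
    exact ⟨by rw [map_mul, h1, h3, one_mul], by rw [dlog_mul v _ _ h3 h1, h2]⟩

lemma Good.theta_supp {adj : ι → ι → Prop} {k : ι →₀ ℕ} {P : MvPowerSeries ι ℂ}
    (h : Good adj k P) (v : ι) (b : ι →₀ ℕ) (hb : coeff b (theta v P) ≠ 0) : Allow k b := by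
  rw [coeff_theta] at hb
  exact h.supp b (right_ne_zero_of_mul hb)

lemma Good.dlog_supp {adj : ι → ι → Prop} {k : ι →₀ ℕ} {P : MvPowerSeries ι ℂ}
    (h : Good adj k P) (v : ι) (b : ι →₀ ℕ) (hb : coeff b (dlog v P) ≠ 0) : Allow k b := by
  unfold dlog at hb
  rw [coeff_mul] at hb
  obtain ⟨p, hp, hne⟩ := Finset.exists_ne_zero_of_sum_ne_zero hb
  rw [Finset.HasAntidiagonal.mem_antidiagonal] at hp
  rw [← hp]
  exact (h.theta_supp v _ (left_ne_zero_of_mul hne)).add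
    (inv_supp h.const h.supp _ (right_ne_zero_of_mul hne))

lemma Good.dlog_coeff {adj : ι → ι → Prop} (hs : ∀ x y, adj x y → adj y x)
    (hi : ∀ x, ¬ adj x x) {k : ι →₀ ℕ} {P : MvPowerSeries ι ℂ}
    (h : Good adj k P) (v : ι) (hconn : Conn adj {v} Finset.univ) :
    coeff k (dlog v P) ≠ 0 := by
  have hkk : k = kk k Finset.univ := by ext i; simp [kk_apply]
  set w : Finset ι → ℂ := fun B => coeff (kk k B) P⁻¹ with hwdef
  have hinv := inv_supp h.const h.supp
  have hw0 : w ∅ = 1 := by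
    have e : kk k ∅ = 0 := by ext i; simp [kk_apply]
    simp only [hwdef, e, coeff_zero_eq_constantCoeff]
    rw [MvPowerSeries.constantCoeff_inv, h.const, inv_one]
  have hw : ∀ B : Finset ι, B.Nonempty → ∑ I ∈ B.powerset, uInd adj I * w (B \ I) = 0 := by
    intro B hB
    have h1 : coeff (kk k B) (P * P⁻¹) = 0 := by
      rw [MvPowerSeries.mul_inv_cancel _ (by rw [h.const]; exact one_ne_zero), coeff_one, if_neg]
      intro h0
      obtain ⟨i, hi⟩ := hB
      have := DFunLike.congr_fun h0 i
      rw [kk_apply, if_pos hi] at this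
      exact absurd this (h.pos i).ne'
    rw [coeff_mul, sum_kk h.pos B (fun a b => coeff a P * coeff b P⁻¹)
      (fun a b hab => ⟨h.supp a (left_ne_zero_of_mul hab), hinv b (right_ne_zero_of_mul hab)⟩)] at h1
    rw [← h1]
    apply Finset.sum_congr rfl
    intro I _
    rw [h.low]
  have hfin : coeff k (dlog v P) = - (k v : ℂ) * rSum adj w {v} Finset.univ := by
    conv_lhs => rw [hkk]
    unfold dlog
    rw [coeff_mul, sum_kk h.pos Finset.univ (fun a b => coeff a (theta v P) * coeff b P⁻¹)
      (fun a b hab => ⟨h.theta_supp v a (left_ne_zero_of_mul hab),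
        hinv b (right_ne_zero_of_mul hab)⟩)]
    have hz := hw Finset.univ ⟨v, by simp⟩
    have e1 : (Finset.univ : Finset ι) = insert v (Finset.univ \ {v}) := by
      ext x; simp
    have hz2 : ∑ I ∈ (insert v (Finset.univ \ {v}) : Finset ι).powerset,
      uInd adj I * w (Finset.univ \ I) = 0 := by rw [← e1]; exact hz
    rw [Finset.sum_powerset_insert (by simp)] at hz2
    have e2 : ∑ I ∈ (Finset.univ : Finset ι).powerset,
        coeff (kk k I) (theta v P) * coeff (kk k (Finset.univ \ I)) P⁻¹ =
        ∑ I ∈ (insert v (Finset.univ \ {v}) : Finset ι).powerset,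
        coeff (kk k I) (theta v P) * coeff (kk k (Finset.univ \ I)) P⁻¹ := by rw [← e1]
    rw [e2, Finset.sum_powerset_insert (by simp)]
    have z1 : ∑ t ∈ (Finset.univ \ {v} : Finset ι).powerset,
        coeff (kk k t) (theta v P) * coeff (kk k (Finset.univ \ t)) P⁻¹ = 0 := by
      apply Finset.sum_eq_zero
      intro t ht
      rw [Finset.mem_powerset] at ht
      have : v ∉ t := fun hv => by simpa using ht hv
      rw [coeff_theta, kk_apply, if_neg this]; simp
    have z2 : ∑ t ∈ (Finset.univ \ {v} : Finset ι).powerset,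
        coeff (kk k (insert v t)) (theta v P) * coeff (kk k (Finset.univ \ (insert v t))) P⁻¹ =
        k v * ∑ t ∈ (Finset.univ \ {v} : Finset ι).powerset,
          uInd adj (insert v t) * w (Finset.univ \ (insert v t)) := by
      rw [Finset.mul_sum]
      apply Finset.sum_congr rfl
      intro t _
      rw [coeff_theta, kk_apply, if_pos (by simp), h.low]; simp only [hwdef]; ring
    rw [z1, z2]
    unfold rSum
    linear_combination (k v : ℂ) * hz2
  obtain ⟨n, hn, hpos⟩ := rSum_nat adj hs hi w hw0 hw _ Finset.univ {v} rfl
  rw [hfin, hn]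
  have := hpos hconn
  have := h.pos v
  simp only [ne_eq, neg_mul, neg_eq_zero, mul_eq_zero, Nat.cast_eq_zero]
  omega

theorem multiset_eq_of_prod {adj : ι → ι → Prop} (hs : ∀ x y, adj x y → adj y x)
    (hi : ∀ x, ¬ adj x x) (v : ι) (hconn : Conn adj {v} Finset.univ)
    (Pf : (ι →₀ ℕ) → MvPowerSeries ι ℂ) (S T : Multiset (ι →₀ ℕ))
    (hS : ∀ k ∈ S, Good adj k (Pf k)) (hT : ∀ k ∈ T, Good adj k (Pf k))
    (h : (S.map Pf).prod = (T.map Pf).prod) : S = T := by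
  have h1 := (dlog_multiset v Pf S (fun k hk => (hS k hk).const)).2
  have h2 := (dlog_multiset v Pf T (fun k hk => (hT k hk).const)).2
  rw [h, h2] at h1
  have hsum : ∀ b, (S.map (fun k => coeff b (dlog v (Pf k)))).sum =
      (T.map (fun k => coeff b (dlog v (Pf k)))).sum := by
    intro b
    have := congrArg (coeff b) h1
    rw [map_multiset_sum, map_multiset_sum, Multiset.map_map, Multiset.map_map] at this
    exact this.symm
  have hg : ∀ k ∈ S + T, Good adj k (Pf k) := fun k hk => by
    rcases Multiset.mem_add.1 hk with hk | hk
    · exact hS k hk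
    · exact hT k hk
  have key : ∀ n : ℕ, ∀ b : ι →₀ ℕ, b.degree = n → S.count b = T.count b := by
    intro n
    induction n using Nat.strong_induction_on with
    | _ n ih =>
    intro b hb
    by_cases hbm : b ∈ S + T
    swap
    · rw [Multiset.mem_add, not_or] at hbm
      rw [Multiset.count_eq_zero_of_notMem hbm.1, Multiset.count_eq_zero_of_notMem hbm.2]
    have hsb := hsum b
    have conv : ∀ U : Multiset (ι →₀ ℕ), U ≤ S + T →
        (U.map (fun k => coeff b (dlog v (Pf k)))).sum =
        ∑ k ∈ (S + T).toFinset, (U.count k : ℂ) * coeff b (dlog v (Pf k)) := by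
      intro U hU
      rw [Finset.sum_multiset_map_count]
      simp only [nsmul_eq_mul]
      apply Finset.sum_subset
      · intro x hx
        rw [Multiset.mem_toFinset] at hx ⊢
        exact Multiset.mem_of_le hU hx
      · intro x _ hx
        rw [Multiset.mem_toFinset] at hx
        rw [Multiset.count_eq_zero_of_notMem hx]; simp
    rw [conv S (Multiset.le_add_right _ _), conv T (Multiset.le_add_left _ _), ← sub_eq_zero,
      ← Finset.sum_sub_distrib, Finset.sum_eq_single b] at hsb
    · rw [← sub_mul] at hsb
      have := (hg b hbm).dlog_coeff hs hi v hconn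
      have := (mul_eq_zero.1 hsb).resolve_right this
      exact_mod_cast sub_eq_zero.1 this
    · intro k hk hkb
      by_cases hz : coeff b (dlog v (Pf k)) = 0
      · rw [hz]; ring
      rw [Multiset.mem_toFinset] at hk
      have hA := (hg k hk).dlog_supp v b hz
      have hle : k ≤ b := fun i => by
        have := hA i; have := (hg b hbm).pos i; omega
      have hlt : k.degree < b.degree := by
        obtain ⟨c, rfl⟩ := exists_add_of_le hle
        rw [map_add]
        have : c.degree ≠ 0 := by
          rw [Ne, Finsupp.degree_eq_zero_iff]; rintro rfl; simp at hkb
        omega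
      rw [ih _ (hb ▸ hlt) k rfl]; ring
    · intro hb'; exact absurd (Multiset.mem_toFinset.2 hbm) hb'
  ext b
  exact key _ b rfl

end PS

end UFT

set_option linter.unusedSectionVars false
namespace UFT
section Skew
variable {ι : Type*} [DecidableEq ι] [Fintype ι]

/-- the coefficient in the dot reflection -/
def cc (A : ι → ι → ℤ) (k : ι →₀ ℕ) (b : ι → ℤ) (j : ι) : ℤ := k j - ∑ i, b i * A i j

/-- skew-symmetric functions with unique dominant exponent -/
structure SkewData (A : ι → ι → ℤ) (k : ι →₀ ℕ) (u : (ι → ℤ) → ℂ) : Prop where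
  diag : ∀ i, A i i = 2
  off : ∀ i j, i ≠ j → A i j ≤ 0
  zero : ∀ i j, A i j = 0 → A j i = 0
  kpos : ∀ i, 0 < k i
  nonneg : ∀ b, u b ≠ 0 → ∀ i, 0 ≤ b i
  one : u 0 = 1
  skew : ∀ b j, u (b + Pi.single j (cc A k b j)) = - u b
  dom : ∀ b, u b ≠ 0 → (∀ j, 0 < cc A k b j) → b = 0

variable {A : ι → ι → ℤ} {k : ι →₀ ℕ} {u : (ι → ℤ) → ℂ}

lemma cc_add (A : ι → ι → ℤ) (k : ι →₀ ℕ) (b : ι → ℤ) (j : ι) (x : ℤ) :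
    cc A k (b + Pi.single j x) j = cc A k b j - x * A j j := by
  unfold cc
  simp only [Pi.add_apply, add_mul, Finset.sum_add_distrib]
  rw [Finset.sum_eq_single (a := j) (f := fun i => (Pi.single j x : ι → ℤ) i * A i j)]
  · simp; ring
  · intro i _ hij; simp [Pi.single_eq_of_ne hij]
  · simp

namespace SkewData

lemma reflect (h : SkewData A k u) (b : ι → ℤ) (j : ι) :
    cc A k (b + Pi.single j (cc A k b j)) j = - cc A k b j := by
  rw [cc_add, h.diag]; ring

lemma reflect' (h : SkewData A k u) (b : ι → ℤ) (j : ι) :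
    b + Pi.single j (cc A k b j) + Pi.single j (cc A k (b + Pi.single j (cc A k b j)) j) = b := by
  rw [h.reflect, add_assoc, ← Pi.single_add]; simp

lemma exists_neg (h : SkewData A k u) (b : ι → ℤ) (hb : u b ≠ 0) (hb0 : b ≠ 0) :
    ∃ j, cc A k b j < 0 := by
  by_contra hcon
  push Not at hcon
  apply hb0
  apply h.dom b hb
  intro j
  rcases (hcon j).lt_or_eq with h1 | h1
  · exact h1
  · exfalso
    have := h.skew b j
    rw [← h1] at this
    simp only [Pi.single_zero, add_zero] at this
    apply hb
    linear_combination this / 2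

lemma up_induction (h : SkewData A k u) (P : (ι → ℤ) → Prop) (h0 : P 0)
    (hP : ∀ b j, u b ≠ 0 → 0 < cc A k b j → P b → P (b + Pi.single j (cc A k b j))) :
    ∀ b, u b ≠ 0 → P b := by
  have key : ∀ N : ℕ, ∀ b : ι → ℤ, u b ≠ 0 → ∑ i, b i = N → P b := by
    intro N
    induction N using Nat.strong_induction_on with
    | _ N ih =>
      intro b hb hN
      by_cases hb0 : b = 0
      · rwa [hb0]
      obtain ⟨j, hj⟩ := h.exists_neg b hb hb0
      set b' := b + Pi.single j (cc A k b j) with hb'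
      have hu' : u b' ≠ 0 := by rw [hb', h.skew]; simpa using hb
      have hs : ∑ i, b' i = N + cc A k b j := by
        rw [hb']; simp [Finset.sum_add_distrib, hN]
      have hnn : 0 ≤ ∑ i, b' i := Finset.sum_nonneg fun i _ => h.nonneg b' hu' i
      have := ih (∑ i, b' i).toNat (by omega) b' hu' (by omega)
      have := hP b' j hu' (by rw [hb', h.reflect]; omega) this
      rwa [hb', h.reflect'] at this
  intro b hb
  exact key (∑ i, b i).toNat b hb (by
    have : 0 ≤ ∑ i, b i := Finset.sum_nonneg fun i _ => h.nonneg b hb i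
    omega)

lemma allow (h : SkewData A k u) (b : ι → ℤ) (hb : u b ≠ 0) : ∀ i, b i = 0 ∨ (k i : ℤ) ≤ b i := by
  refine h.up_induction (fun b => ∀ i, b i = 0 ∨ (k i : ℤ) ≤ b i) (by simp) ?_ b hb
  clear hb b
  intro b j hb hj ih i
  by_cases hij : i = j
  · subst hij
    right
    rw [Pi.add_apply, Pi.single_eq_same]
    rcases ih i with h1 | h1
    · have : ∑ l, b l * A l i ≤ 0 := by
        apply Finset.sum_nonpos
        intro l _
        by_cases hl : l = i
        · subst hl; simp [h1]
        · exact mul_nonpos_of_nonneg_of_nonpos (h.nonneg b hb l) (h.off l i hl)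
      unfold cc; omega
    · omega
  · simp [Pi.single_eq_of_ne hij, ih i]

lemma unique {u' : (ι → ℤ) → ℂ} (h : SkewData A k u) (h' : SkewData A k u') : u = u' := by
  have key : ∀ {u u' : (ι → ℤ) → ℂ}, SkewData A k u → SkewData A k u' → 
      ∀ b, u b ≠ 0 → u b = u' b := by
    intro u u' h h' b hb
    refine h.up_induction (fun b => u b = u' b) (by rw [h.one, h'.one]) ?_ b hb
    intro b j _ _ hh
    rw [h.skew, h'.skew, hh]
  ext b
  by_cases hb : u b = 0
  · by_cases hb' : u' b = 0
    · rw [hb, hb']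
    · exact (key h' h b hb').symm
  · exact key h h' b hb

lemma const (h : SkewData A k u) (N : (ι → ℤ) → ℂ)
    (hN : ∀ b j, N (b + Pi.single j (cc A k b j)) = N b) : ∀ b, u b ≠ 0 → N b = N 0 := by
  refine h.up_induction _ rfl ?_
  intro b j _ _ hh
  rw [hN, hh]

/-- The exponent attached to a finite set. -/
def kz (k : ι →₀ ℕ) (I : Finset ι) : ι → ℤ := fun i => if i ∈ I then k i else 0

lemma cc_kz (h : SkewData A k u) (I : Finset ι) (j : ι) (hj : j ∈ I) :
    cc A k (kz k I) j = - k j - ∑ i ∈ I.erase j, k i * A i j := by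
  unfold cc kz
  simp only [ite_mul, zero_mul]
  rw [Finset.sum_ite_mem, Finset.univ_inter, ← Finset.add_sum_erase _ _ hj, h.diag]
  ring

lemma isolated (h : SkewData A k u) (I : Finset ι) (j : ι) (hj : j ∈ I)
    (hiso : ∀ i ∈ I.erase j, A i j = 0) : u (kz k I) = - u (kz k (I.erase j)) := by
  have h1 := h.skew (kz k I) j
  have h2 : kz k I + Pi.single j (cc A k (kz k I) j) = kz k (I.erase j) := by
    rw [h.cc_kz I j hj, Finset.sum_eq_zero (fun i hi => by rw [hiso i hi, mul_zero])]
    ext i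
    rw [Pi.add_apply]
    unfold kz
    by_cases hij : i = j
    · subst hij; simp [hj]
    · simp [Pi.single_eq_of_ne hij, hij]
  rw [h2] at h1
  rw [h1, neg_neg]

/-- Adjacency in the Dynkin diagram. -/
def dadj (A : ι → ι → ℤ) (i j : ι) : Prop := i ≠ j ∧ A i j ≠ 0

lemma uInd_isolated (h : SkewData A k u) (I : Finset ι) (j : ι) (hj : j ∈ I)
    (hiso : ∀ i ∈ I.erase j, A i j = 0) : uInd (dadj A) I = - uInd (dadj A) (I.erase j) := by
  unfold uInd
  have e : (∀ x ∈ I, ∀ y ∈ I, ¬ dadj A x y) ↔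
      (∀ x ∈ I.erase j, ∀ y ∈ I.erase j, ¬ dadj A x y) := by
    constructor
    · intro hh x hx y hy
      exact hh x (Finset.mem_of_mem_erase hx) y (Finset.mem_of_mem_erase hy)
    · intro hh x hx y hy hxy
      by_cases h1 : x = j
      · subst h1
        exact hxy.2 (h.zero _ _ (hiso y (Finset.mem_erase.2 ⟨hxy.1.symm, hy⟩)))
      · by_cases h2 : y = j
        · subst h2
          exact hxy.2 (hiso x (Finset.mem_erase.2 ⟨hxy.1, hx⟩))
        · exact hh x (Finset.mem_erase.2 ⟨h1, hx⟩) y (Finset.mem_erase.2 ⟨h2, hy⟩) hxy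
  have hc : I.card = (I.erase j).card + 1 := (Finset.card_erase_add_one hj).symm
  by_cases hI : ∀ x ∈ I, ∀ y ∈ I, ¬ dadj A x y
  · rw [if_pos hI, if_pos (e.1 hI), hc, pow_succ]; ring
  · rw [if_neg hI, if_neg (fun hh => hI (e.2 hh)), neg_zero]

lemma low (h : SkewData A k u) : ∀ (N : ℕ) (I : Finset ι), I.card = N →
    u (kz k I) = uInd (dadj A) I := by
  intro N
  induction N with
  | zero =>
    intro I hI
    rw [Finset.card_eq_zero] at hI
    subst hI
    have : kz k (∅ : Finset ι) = 0 := by ext i; simp [kz]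
    rw [this, h.one]; simp [uInd]
  | succ N ih =>
    intro I hI
    by_cases hex : ∃ j ∈ I, ∀ i ∈ I.erase j, A i j = 0
    · obtain ⟨j, hj, hiso⟩ := hex
      rw [h.isolated I j hj hiso, h.uInd_isolated I j hj hiso, ih]
      rw [Finset.card_erase_of_mem hj, hI]; rfl
    · have hne : I.Nonempty := by rw [← Finset.card_pos]; omega
      have h1 : uInd (dadj A) I = 0 := by
        unfold uInd
        rw [if_neg]
        intro hh
        obtain ⟨j, hj⟩ := hne
        apply hex
        refine ⟨j, hj, fun i hi => ?_⟩
        by_contra hA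
        exact hh i (Finset.mem_of_mem_erase hi) j hj ⟨Finset.ne_of_mem_erase hi, hA⟩
      rw [h1]
      by_contra hu
      have hk0 : kz k I ≠ 0 := by
        obtain ⟨j, hj⟩ := hne
        intro hh
        have h2 := congrFun hh j
        simp only [kz, hj, if_true, Pi.zero_apply] at h2
        have := h.kpos j
        omega
      obtain ⟨j, hj⟩ := h.exists_neg _ hu hk0
      have hu' : u (kz k I + Pi.single j (cc A k (kz k I) j)) ≠ 0 := by
        rw [h.skew]; simpa using hu
      have hn := h.nonneg _ hu' j
      have ha := h.allow _ hu' j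
      rw [Pi.add_apply, Pi.single_eq_same] at hn ha
      by_cases hjI : j ∈ I
      · apply hex
        refine ⟨j, hjI, ?_⟩
        have hkj : kz k I j = k j := by simp [kz, hjI]
        rw [hkj] at hn ha
        have hc : cc A k (kz k I) j = - k j := by omega
        rw [h.cc_kz I j hjI] at hc
        have hsum : ∑ i ∈ I.erase j, (k i : ℤ) * A i j = 0 := by omega
        rw [Finset.sum_eq_zero_iff_of_nonpos] at hsum
        · intro i hi
          have := hsum i hi
          have hp := h.kpos i
          rcases mul_eq_zero.1 this with h3 | h3
          · omega
          · exact h3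
        · intro i hi
          exact mul_nonpos_of_nonneg_of_nonpos (by positivity)
            (h.off i j (Finset.ne_of_mem_erase hi))
      · have hkj : kz k I j = 0 := by simp [kz, hjI]
        omega

/-- The associated power series. -/
noncomputable def ser (u : (ι → ℤ) → ℂ) : MvPowerSeries ι ℂ := fun b => u (fun i => (b i : ℤ))

lemma coeff_ser (u : (ι → ℤ) → ℂ) (b : ι →₀ ℕ) :
    MvPowerSeries.coeff b (ser u) = u (fun i => (b i : ℤ)) := rfl

lemma good (h : SkewData A k u) : Good (dadj A) k (ser u) where
  pos := h.kpos
  supp b hb i := by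
    rw [coeff_ser] at hb
    have := h.allow _ hb i
    omega
  low I := by
    rw [coeff_ser, ← h.low _ I rfl]
    congr 1
    ext i
    rw [kk_apply]; unfold kz; split_ifs <;> simp

lemma dadj_symm (h : SkewData A k u) (x y : ι) (hxy : dadj A x y) : dadj A y x :=
  ⟨hxy.1.symm, fun hh => hxy.2 (h.zero _ _ hh)⟩

end SkewData

end Skew
end UFT

set_option linter.unusedSectionVars false
namespace UFT
section CDsec

open Module

/-- Combinatorial data extracted from a root system with a base. -/
structure CD (H : Type) [AddCommGroup H] [Module ℂ H] (ι : Type) [Fintype ι] [DecidableEq ι] where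
  a : ι → Dual ℂ H
  hc : ι → H
  A : ι → ι → ℤ
  hA : ∀ i j, a i (hc j) = A i j
  diag : ∀ i, A i i = 2
  off : ∀ i j, i ≠ j → A i j ≤ 0
  zero : ∀ i j, A i j = 0 → A j i = 0
  P : Finset (Dual ℂ H)
  aP : ∀ i, a i ∈ P
  perm : ∀ i, ∀ α ∈ P, α ≠ a i → α - α (hc i) • a i ∈ P
  Pcomb : ∀ α ∈ P, ∃ n : ι →₀ ℕ, n ≠ 0 ∧ α = ∑ i, (n i : ℂ) • a i
  lin : LinearIndependent ℂ a
  sep : ∀ μ : Dual ℂ H, (∀ i, μ (hc i) = 0) → μ = 0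
  B : Dual ℂ H →ₗ[ℂ] Dual ℂ H →ₗ[ℂ] ℂ
  Bsymm : ∀ μ ν, B μ ν = B ν μ
  Bref : ∀ i μ, B (a i) μ = B (a i) (a i) / 2 * μ (hc i)
  Bsq : ∀ μ, B μ μ = 2 * ∑ γ ∈ P, (B γ μ) ^ 2
  Bne : ∀ i, B (a i) (a i) ≠ 0
  J : Type
  [finJ : Fintype J]
  u : J → H
  u' : J → H
  hB : ∀ μ ν, B μ ν = ∑ j, μ (u j) * ν (u' j)
  t : Dual ℂ H → H
  ht : ∀ μ ν : Dual ℂ H, ν (t μ) = B μ ν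
  v0 : ι
  conn : Conn (SkewData.dadj A) {v0} Finset.univ

attribute [instance] CD.finJ

variable {H : Type} [AddCommGroup H] [Module ℂ H] {ι : Type} [Fintype ι] [DecidableEq ι]

namespace CD

/-- The negative cone embedding. -/
noncomputable def psi (D : CD H ι) : (ι →₀ ℕ) →+ Dual ℂ H where
  toFun b := - ∑ i, (b i : ℂ) • D.a i
  map_zero' := by simp
  map_add' x y := by simp [add_smul, Finset.sum_add_distrib]; abel

lemma psi_apply (D : CD H ι) (b : ι →₀ ℕ) : D.psi b = - ∑ i, (b i : ℂ) • D.a i := rfl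

/-- integral combinations -/
noncomputable def beta (D : CD H ι) (b : ι → ℤ) : Dual ℂ H := ∑ i, (b i : ℂ) • D.a i

lemma beta_inj (D : CD H ι) {b b' : ι → ℤ} (h : D.beta b = D.beta b') : b = b' := by
  have h1 : ∑ i, ((b i : ℂ) - b' i) • D.a i = 0 := by
    simp only [sub_smul, Finset.sum_sub_distrib]
    unfold beta at h
    rw [h, sub_self]
  have := Fintype.linearIndependent_iff.1 D.lin _ h1
  ext i
  have h2 := this i
  rw [sub_eq_zero] at h2
  exact_mod_cast h2

lemma beta_add (D : CD H ι) (b b' : ι → ℤ) : D.beta (b + b') = D.beta b + D.beta b' := by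
  simp [beta, add_smul, Finset.sum_add_distrib]

lemma beta_single (D : CD H ι) (i : ι) (x : ℤ) : D.beta (Pi.single i x) = (x : ℂ) • D.a i := by
  unfold beta
  rw [Finset.sum_eq_single i]
  · simp
  · intro j _ hj; simp [Pi.single_eq_of_ne hj]
  · simp

lemma psi_eq (D : CD H ι) (b : ι →₀ ℕ) : D.psi b = - D.beta (fun i => (b i : ℤ)) := by
  simp [psi_apply, beta]

lemma psi_inj (D : CD H ι) : Function.Injective D.psi := by
  intro b b' h
  rw [psi_eq, psi_eq, neg_inj] at h
  have := D.beta_inj h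
  ext i
  exact_mod_cast congrFun this i

lemma beta_hc (D : CD H ι) (b : ι → ℤ) (j : ι) :
    D.beta b (D.hc j) = ((∑ i, b i * D.A i j : ℤ) : ℂ) := by
  unfold beta
  simp [D.hA]

lemma psi_hc (D : CD H ι) (b : ι →₀ ℕ) (j : ι) :
    D.psi b (D.hc j) = ((- ∑ i, (b i : ℤ) * D.A i j : ℤ) : ℂ) := by
  rw [psi_eq, LinearMap.neg_apply, beta_hc]; push_cast; rfl

lemma P_hc (D : CD H ι) {α : Dual ℂ H} (hα : α ∈ D.P) (j : ι) : ∃ z : ℤ, α (D.hc j) = z := by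
  obtain ⟨n, _, rfl⟩ := D.Pcomb α hα
  exact ⟨_, D.beta_hc (fun i => (n i : ℤ)) j⟩

lemma r_pos (D : CD H ι) (i : ι) : ∃ r : ℝ, 0 < r ∧ D.B (D.a i) (D.a i) = r := by
  have h1 := D.Bsq (D.a i)
  have h2 := D.Bne i
  set r := D.B (D.a i) (D.a i) with hr
  choose! z hz using fun α (hα : α ∈ D.P) => D.P_hc hα i
  have h3 : ∑ γ ∈ D.P, (D.B γ (D.a i)) ^ 2 = r ^ 2 / 4 * ((∑ γ ∈ D.P, (z γ) ^ 2 : ℤ) : ℂ) := by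
    push_cast
    rw [Finset.mul_sum]
    apply Finset.sum_congr rfl
    intro γ hγ
    rw [D.Bsymm, D.Bref, hz γ hγ, ← hr]; ring
  rw [h3] at h1
  set Z := ∑ γ ∈ D.P, (z γ) ^ 2 with hZ
  have hZ0 : 0 ≤ Z := Finset.sum_nonneg fun _ _ => sq_nonneg _
  have h4 : r * Z = 2 := by
    have : r * (r * Z - 2) = 0 := by linear_combination -2 * h1
    rcases mul_eq_zero.1 this with h | h
    · exact absurd h h2
    · linear_combination h
  have hZne : Z ≠ 0 := by
    rintro h
    rw [h] at h4; simp at h4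
  have hZpos : 0 < Z := lt_of_le_of_ne hZ0 (Ne.symm hZne)
  refine ⟨2 / Z, by positivity, ?_⟩
  have : (Z : ℂ) ≠ 0 := by exact_mod_cast hZne
  push_cast
  field_simp
  exact h4

/-- Half squared lengths. -/
noncomputable def r (D : CD H ι) (i : ι) : ℝ := (D.r_pos i).choose
lemma r_pos' (D : CD H ι) (i : ι) : 0 < D.r i := (D.r_pos i).choose_spec.1
lemma r_eq (D : CD H ι) (i : ι) : D.B (D.a i) (D.a i) = D.r i := (D.r_pos i).choose_spec.2

lemma B_beta (D : CD H ι) (b : ι → ℤ) (μ : Dual ℂ H) :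
    D.B (D.beta b) μ = ∑ i, (b i : ℂ) * (D.r i / 2) * μ (D.hc i) := by
  unfold beta
  rw [map_sum, LinearMap.sum_apply]
  apply Finset.sum_congr rfl
  intro i _
  rw [map_smul, LinearMap.smul_apply, D.Bref, r_eq, smul_eq_mul]; ring

lemma posdef (D : CD H ι) (b : ι → ℤ) : ∃ x : ℝ, D.B (D.beta b) (D.beta b) = x ∧ 0 ≤ x ∧
    (x = 0 → b = 0) := by
  have hex : ∀ γ ∈ D.P, ∃ y : ℝ, D.B γ (D.beta b) = y := by
    intro γ hγ
    obtain ⟨n, _, rfl⟩ := D.Pcomb γ hγ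
    have := D.B_beta (fun i => (n i : ℤ)) (D.beta b)
    simp only [beta_hc] at this
    refine ⟨∑ i, (n i : ℝ) * (D.r i / 2) * ((∑ l, b l * D.A l i : ℤ) : ℝ), ?_⟩
    rw [show (∑ i, (n i : ℂ) • D.a i) = D.beta (fun i => (n i : ℤ)) by simp [beta], this]
    push_cast; rfl
  choose! y hy using hex
  refine ⟨2 * ∑ γ ∈ D.P, y γ ^ 2, ?_, ?_, ?_⟩
  · rw [D.Bsq]
    push_cast
    congr 1
    apply Finset.sum_congr rfl
    intro γ hγ
    rw [hy γ hγ]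
  · have : 0 ≤ ∑ γ ∈ D.P, y γ ^ 2 := Finset.sum_nonneg fun _ _ => sq_nonneg _
    positivity
  · intro h
    have h0 : ∑ γ ∈ D.P, y γ ^ 2 = 0 := by linarith
    rw [Finset.sum_eq_zero_iff_of_nonneg (fun _ _ => sq_nonneg _)] at h0
    have hz : D.beta b = 0 := by
      apply D.sep
      intro i
      have h1 := h0 _ (D.aP i)
      have h2 := hy _ (D.aP i)
      rw [pow_eq_zero_iff (by norm_num)] at h1
      rw [h1, D.Bref, r_eq] at h2
      have := (D.r_pos' i).ne'
      simpa [this] using h2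
    apply D.beta_inj
    rw [hz]; simp [beta]

lemma dom_Q (D : CD H ι) (b : ι → ℤ) (hb : ∀ i, 0 ≤ b i)
    (h : ∀ j, ∑ i, b i * D.A i j ≤ 0) : b = 0 := by
  obtain ⟨x, hx, hx0, hx1⟩ := D.posdef b
  apply hx1
  refine le_antisymm ?_ hx0
  rw [B_beta] at hx
  simp only [beta_hc] at hx
  have hx' : x = ∑ i, (b i : ℝ) * (D.r i / 2) * ((∑ l, b l * D.A l i : ℤ) : ℝ) := by
    apply Complex.ofReal_injective
    rw [← hx]; push_cast; rfl
  rw [hx']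
  apply Finset.sum_nonpos
  intro i _
  have h1 : (0 : ℝ) ≤ b i := by exact_mod_cast hb i
  have h2 := (D.r_pos' i).le
  have h3 : ((∑ l, b l * D.A l i : ℤ) : ℝ) ≤ 0 := by exact_mod_cast h i
  exact mul_nonpos_of_nonneg_of_nonpos (by positivity) h3

lemma dom_V (D : CD H ι) (b : ι → ℤ) (hb : ∀ i, 0 ≤ b i) (l : Dual ℂ H) (k : ι →₀ ℕ)
    (hk : ∀ i, l (D.hc i) = k i)
    (hB : D.B (l - D.beta b) (l - D.beta b) = D.B l l)
    (h : ∀ j, 0 < cc D.A k b j) : b = 0 := by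
  have h1 : D.B (D.beta b) (l + (l - D.beta b)) = 0 := by
    simp only [map_sub, map_add, LinearMap.sub_apply] at hB ⊢
    rw [D.Bsymm l (D.beta b)] at hB
    linear_combination -hB
  rw [B_beta] at h1
  have hx' : ∑ i, (b i : ℝ) * (D.r i / 2) * ((k i : ℝ) + cc D.A k b i) = 0 := by
    apply Complex.ofReal_injective
    rw [Complex.ofReal_zero, ← h1]
    push_cast
    apply Finset.sum_congr rfl
    intro i _
    simp only [LinearMap.add_apply, LinearMap.sub_apply, hk, beta_hc]
    unfold cc; push_cast; rfl
  have hp : ∀ i, 0 < D.r i / 2 * ((k i : ℝ) + cc D.A k b i) := by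
    intro i
    have h2 := D.r_pos' i
    have h3 : (0 : ℝ) < cc D.A k b i := by exact_mod_cast h i
    positivity
  rw [Finset.sum_eq_zero_iff_of_nonneg] at hx'
  · ext i
    have := hx' i (Finset.mem_univ _)
    rw [mul_assoc] at this
    rcases mul_eq_zero.1 this with h3 | h3
    · exact_mod_cast h3
    · exact absurd h3 (hp i).ne'
  · intro i _
    have h1 : (0 : ℝ) ≤ b i := by exact_mod_cast hb i
    rw [mul_assoc]
    exact mul_nonneg h1 (hp i).le

end CD
end CDsec
end UFT

set_option linter.unusedSectionVars false
namespace UFT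
section GA

open Module

variable {H : Type} [AddCommGroup H] [Module ℂ H] {ι : Type} [Fintype ι] [DecidableEq ι]

/-- The group algebra of the weight space. -/
abbrev GAlg (H : Type) [AddCommGroup H] [Module ℂ H] := AddMonoidAlgebra ℂ (Dual ℂ H)

/-- Formal exponentials. -/
noncomputable def ex (μ : Dual ℂ H) : GAlg H := AddMonoidAlgebra.single μ 1

lemma ex_add (μ ν : Dual ℂ H) : ex (μ + ν) = ex μ * ex ν := by
  simp [ex, AddMonoidAlgebra.single_mul_single]

lemma ex_zero : ex (0 : Dual ℂ H) = 1 := rfl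

lemma single_eq (μ : Dual ℂ H) (c : ℂ) : AddMonoidAlgebra.single μ c = c • ex μ := by
  simp [ex]

/-- induction on sums of exponentials -/
lemma ga_induction {p : GAlg H → Prop} (f : GAlg H) (h0 : p 0)
    (hadd : ∀ f g, p f → p g → p (f + g)) (hs : ∀ (μ : Dual ℂ H) (c : ℂ), p (c • ex μ)) : p f :=
  AddMonoidAlgebra.induction_linear f h0 hadd (fun μ c => by rw [single_eq]; exact hs μ c)

/-- Diagonal operator. -/
noncomputable def op (φ : Dual ℂ H → ℂ) : GAlg H →ₗ[ℂ] GAlg H where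
  toFun f := AddMonoidAlgebra.ofCoeff (Finsupp.onFinset f.coeff.support (fun μ => φ μ * f.coeff μ)
    (fun μ h => by
      rw [Finsupp.mem_support_iff]; exact right_ne_zero_of_mul h))
  map_add' f g := by
    ext μ
    simp [mul_add]
  map_smul' c f := by
    ext μ
    simp; ring

lemma coeff_op (φ : Dual ℂ H → ℂ) (f : GAlg H) (μ : Dual ℂ H) :
    (op φ f).coeff μ = φ μ * f.coeff μ := rfl

lemma op_ex (φ : Dual ℂ H → ℂ) (μ : Dual ℂ H) : op φ (ex μ) = φ μ • ex μ := by
  classical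
  ext ν
  rw [coeff_op]
  simp only [ex, AddMonoidAlgebra.coeff_smul, AddMonoidAlgebra.coeff_single, Finsupp.smul_apply,
    Finsupp.single_apply, smul_eq_mul]
  split_ifs with h
  · rw [h]
  · simp

/-- Directional derivative. -/
noncomputable def der (h : H) : GAlg H →ₗ[ℂ] GAlg H := op (fun μ => μ h)

lemma der_ex (h : H) (μ : Dual ℂ H) : der h (ex μ) = μ h • ex μ := op_ex _ _

lemma bilin_ext {F G : GAlg H → GAlg H → GAlg H}
    (F0 : ∀ g, F 0 g = G 0 g) (F0' : ∀ f, F f 0 = G f 0)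
    (Fa : ∀ f f' g, F (f + f') g = F f g + F f' g) (Fa' : ∀ f g g', F f (g + g') = F f g + F f g')
    (Ga : ∀ f f' g, G (f + f') g = G f g + G f' g) (Ga' : ∀ f g g', G f (g + g') = G f g + G f g')
    (h : ∀ (μ ν : Dual ℂ H) (c d : ℂ), F (c • ex μ) (d • ex ν) = G (c • ex μ) (d • ex ν))
    (f g : GAlg H) : F f g = G f g := by
  induction f using ga_induction with
  | h0 => exact F0 g
  | hadd f f' h1 h2 => rw [Fa, Ga, h1, h2]
  | hs μ c =>
    induction g using ga_induction with
    | h0 => exact F0' _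
    | hadd g g' h1 h2 => rw [Fa', Ga', h1, h2]
    | hs ν d => exact h μ ν c d

lemma der_mul (x : H) (f g : GAlg H) : der x (f * g) = der x f * g + f * der x g := by
  apply bilin_ext (F := fun f g => der x (f * g)) (G := fun f g => der x f * g + f * der x g)
  · simp
  · simp
  · intros; simp [add_mul]
  · intros; simp [mul_add]
  · intros; simp [add_mul]; ring
  · intros; simp [mul_add]; ring
  · intro μ ν c d
    simp only [map_smul, ← ex_add, der_ex, smul_mul_assoc, mul_smul_comm]
    simp only [smul_smul, ← add_smul, LinearMap.add_apply]
    congr 1; ring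

lemma der_prod {κ : Type} [DecidableEq κ] (x : H) (s : Finset κ) (f : κ → GAlg H) :
    der x (∏ i ∈ s, f i) = ∑ i ∈ s, (∏ j ∈ s.erase i, f j) * der x (f i) := by
  induction s using Finset.induction_on with
  | empty => 
    simp only [Finset.prod_empty, Finset.sum_empty]
    rw [← ex_zero, der_ex]; simp
  | insert i s hi ih =>
    rw [Finset.prod_insert hi, der_mul, ih, Finset.sum_insert hi, Finset.erase_insert hi,
      Finset.mul_sum]
    congr 1
    · ring
    · apply Finset.sum_congr rfl
      intro j hj
      have : (insert i s).erase j = insert i (s.erase j) := by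
        rw [Finset.erase_insert_of_ne]; rintro rfl; exact hi hj
      rw [this, Finset.prod_insert (fun h => hi (Finset.mem_of_mem_erase h))]; ring

namespace CD

variable (D : CD H ι)

/-- The Laplacian. -/
noncomputable def Lap : GAlg H →ₗ[ℂ] GAlg H := op (fun μ => D.B μ μ)

lemma Lap_ex (μ : Dual ℂ H) : D.Lap (ex μ) = D.B μ μ • ex μ := op_ex _ _

lemma Lap_mul (f g : GAlg H) : D.Lap (f * g) = D.Lap f * g + f * D.Lap g +
    (2 : ℂ) • ∑ j, der (D.u j) f * der (D.u' j) g := by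
  apply bilin_ext (F := fun f g => D.Lap (f * g)) (G := fun f g => D.Lap f * g + f * D.Lap g +
    (2 : ℂ) • ∑ j, der (D.u j) f * der (D.u' j) g)
  · simp
  · simp
  · intros; simp [add_mul]
  · intros; simp [mul_add]
  · intros; simp [add_mul, Finset.sum_add_distrib]; ring
  · intros; simp [mul_add, Finset.sum_add_distrib]; ring
  · intro μ ν c d
    simp only [map_smul, ← ex_add, Lap_ex, der_ex, smul_mul_assoc,
      mul_smul_comm]
    simp only [smul_smul, ← Finset.sum_smul, ← add_smul]
    congr 1
    have e2 : ∑ j, d * (ν (D.u' j) * (c * μ (D.u j))) = d * c * D.B μ ν := by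
      rw [D.hB, Finset.mul_sum]; exact Finset.sum_congr rfl fun j _ => by ring
    simp only [map_add, LinearMap.add_apply, D.Bsymm ν μ]
    rw [e2]; ring

/-- Simple reflection. -/
noncomputable def s (i : ι) : Dual ℂ H →ₗ[ℂ] Dual ℂ H where
  toFun μ := μ - μ (D.hc i) • D.a i
  map_add' x y := by simp [add_smul]; abel
  map_smul' c x := by simp [smul_sub, smul_smul]

lemma s_apply (i : ι) (μ : Dual ℂ H) : D.s i μ = μ - μ (D.hc i) • D.a i := rfl

lemma a_hc_self (i : ι) : D.a i (D.hc i) = 2 := by rw [D.hA, D.diag]; norm_num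

lemma s_s (i : ι) (μ : Dual ℂ H) : D.s i (D.s i μ) = μ := by
  simp only [s_apply, LinearMap.sub_apply, LinearMap.smul_apply, a_hc_self, smul_eq_mul]
  rw [sub_sub, ← add_smul]
  ring_nf; simp

lemma s_inj (i : ι) : Function.Injective (D.s i) :=
  Function.LeftInverse.injective (D.s_s i)

lemma s_a (i : ι) : D.s i (D.a i) = - D.a i := by
  rw [s_apply, a_hc_self, two_smul]; abel

lemma B_s (i : ι) (μ : Dual ℂ H) : D.B (D.s i μ) (D.s i μ) = D.B μ μ := by
  simp only [s_apply, map_sub, LinearMap.sub_apply, map_smul, LinearMap.smul_apply, smul_eq_mul]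
  rw [D.Bsymm μ (D.a i), D.Bref i μ]; ring

/-- Reflection on the group algebra. -/
noncomputable def sig (i : ι) : GAlg H →+* GAlg H :=
  AddMonoidAlgebra.mapDomainRingHom ℂ (D.s i).toAddMonoidHom

lemma sig_ex (i : ι) (μ : Dual ℂ H) : D.sig i (ex μ) = ex (D.s i μ) := by
  simp [sig, ex, AddMonoidAlgebra.mapDomain_single]

lemma sig_coeff (i : ι) (f : GAlg H) (μ : Dual ℂ H) : (D.sig i f).coeff (D.s i μ) = f.coeff μ := by
  exact Finsupp.mapDomain_apply (D.s_inj i) f.coeff μ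


lemma a_ne (i : ι) : D.a i ≠ 0 := D.lin.ne_zero i

lemma neg_a_not_mem (i : ι) : - D.a i ∉ D.P := by
  intro h
  obtain ⟨n, hn, h1⟩ := D.Pcomb _ h
  have h2 : D.beta (fun j => (n j : ℤ) + (Pi.single i 1 : ι → ℤ) j) = D.beta 0 := by
    have := D.beta_add (fun j => (n j : ℤ)) (Pi.single i 1)
    rw [D.beta_single] at this
    have e : D.beta (fun j => (n j : ℤ)) = - D.a i := by rw [h1]; simp [beta]
    rw [e] at this
    have h0 : D.beta 0 = 0 := by simp [beta]
    rw [h0]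
    exact this.trans (by simp)
  have h3 := congrFun (D.beta_inj h2) i
  simp at h3
  omega

open Classical in
lemma perm' (i : ι) (α : Dual ℂ H) (hα : α ∈ D.P.erase (D.a i)) :
    D.s i α ∈ D.P.erase (D.a i) := by
  rw [Finset.mem_erase] at hα ⊢
  refine ⟨?_, D.perm i α hα.2 hα.1⟩
  intro h
  have : α = - D.a i := by rw [← D.s_s i α, h, s_a]
  exact D.neg_a_not_mem i (this ▸ hα.2)

/-- The Weyl denominator. -/
noncomputable def Q : GAlg H := ∏ α ∈ D.P, (ex ((1 / 2 : ℂ) • α) - ex (-((1 / 2 : ℂ) • α)))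

/-- Half sum of positive roots. -/
noncomputable def rho : Dual ℂ H := ∑ α ∈ D.P, (1 / 2 : ℂ) • α

open Classical in
lemma sig_Q (i : ι) : D.sig i D.Q = - D.Q := by
  unfold Q
  rw [map_prod, ← Finset.mul_prod_erase _ _ (D.aP i), ← Finset.mul_prod_erase _ _ (D.aP i)]
  simp only [map_sub, sig_ex, map_neg, map_smul, s_a, smul_neg, neg_neg]
  have : ∏ x ∈ D.P.erase (D.a i), (ex ((1 / 2 : ℂ) • D.s i x) - ex (-((1 / 2 : ℂ) • D.s i x))) =
      ∏ x ∈ D.P.erase (D.a i), (ex ((1 / 2 : ℂ) • x) - ex (-((1 / 2 : ℂ) • x))) := by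
    apply Finset.prod_nbij' (D.s i) (D.s i)
    · exact D.perm' i
    · exact D.perm' i
    · intro x _; exact D.s_s i x
    · intro x _; exact D.s_s i x
    · intro x _; rfl
  rw [this]; ring

open Classical in
lemma s_rho (i : ι) : D.s i D.rho = D.rho - D.a i := by
  unfold rho
  rw [map_sum, ← Finset.add_sum_erase _ _ (D.aP i), ← Finset.add_sum_erase _ _ (D.aP i)]
  have : ∑ x ∈ D.P.erase (D.a i), D.s i ((1 / 2 : ℂ) • x) =
      ∑ x ∈ D.P.erase (D.a i), (1 / 2 : ℂ) • x := by
    apply Finset.sum_nbij' (D.s i) (D.s i)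
    · exact D.perm' i
    · exact D.perm' i
    · intro x _; exact D.s_s i x
    · intro x _; exact D.s_s i x
    · intro x _; exact map_smul _ _ _
  rw [this, map_smul, s_a]
  module

lemma rho_hc (i : ι) : D.rho (D.hc i) = 1 := by
  have h := D.s_rho i
  rw [s_apply] at h
  have h1 : (1 - D.rho (D.hc i)) • D.a i = 0 := by
    have : D.rho (D.hc i) • D.a i = D.a i := by
      have := sub_right_inj.1 h; exact this
    rw [sub_smul, one_smul, this, sub_self]
  rcases smul_eq_zero.1 h1 with h2 | h2
  · linear_combination -h2
  · exact absurd h2 (D.a_ne i)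

/-- embedding of polynomials -/
noncomputable def phi : MvPolynomial ι ℂ →+* GAlg H := AddMonoidAlgebra.mapDomainRingHom ℂ D.psi

lemma phi_coeff (p : MvPolynomial ι ℂ) (b : ι →₀ ℕ) : (D.phi p).coeff (D.psi b) = p.coeff b :=
  Finsupp.mapDomain_apply D.psi_inj (AddMonoidAlgebra.coeff p) b

lemma phi_coeff_ne (p : MvPolynomial ι ℂ) (μ : Dual ℂ H) (h : (D.phi p).coeff μ ≠ 0) :
    ∃ b, μ = D.psi b := by
  by_contra hc
  push Not at hc
  apply h
  refine Finsupp.mapDomain_of_notMem_range (AddMonoidAlgebra.coeff p) μ ?_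
  rintro ⟨b, hb⟩
  exact hc b hb.symm

lemma phi_monomial (b : ι →₀ ℕ) : D.phi (MvPolynomial.monomial b 1) = ex (D.psi b) := by
  exact AddMonoidAlgebra.mapDomain_single

/-- `f` has leading exponent `l` and normalised polynomial `p`. -/
def Lead (l : Dual ℂ H) (f : GAlg H) (p : MvPolynomial ι ℂ) : Prop :=
  f = ex l * D.phi p ∧ MvPolynomial.constantCoeff p = 1

lemma ex_mul_coeff (l μ : Dual ℂ H) (f : GAlg H) : (ex l * f).coeff (l + μ) = f.coeff μ := by
  simp [ex]

variable {D}

lemma Lead.mul {l l' : Dual ℂ H} {f f' : GAlg H} {p p' : MvPolynomial ι ℂ}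
    (h : D.Lead l f p) (h' : D.Lead l' f' p') : D.Lead (l + l') (f * f') (p * p') := by
  refine ⟨?_, ?_⟩
  · rw [h.1, h'.1, ex_add, map_mul]; ring
  · rw [map_mul, h.2, h'.2, mul_one]

lemma Lead.one : D.Lead 0 1 1 := ⟨by rw [ex_zero, map_one, one_mul], map_one _⟩

lemma Lead.prod {κ : Type} (t : Finset κ) (l : κ → Dual ℂ H) (f : κ → GAlg H)
    (p : κ → MvPolynomial ι ℂ) (h : ∀ i ∈ t, D.Lead (l i) (f i) (p i)) :
    D.Lead (∑ i ∈ t, l i) (∏ i ∈ t, f i) (∏ i ∈ t, p i) := by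
  classical
  induction t using Finset.induction_on with
  | empty => exact Lead.one
  | insert i t hi ih =>
    rw [Finset.sum_insert hi, Finset.prod_insert hi, Finset.prod_insert hi]
    exact (h i (by simp)).mul (ih fun j hj => h j (by simp [hj]))

lemma Lead.pow {l : Dual ℂ H} {f : GAlg H} {p : MvPolynomial ι ℂ}
    (h : D.Lead l f p) (n : ℕ) : D.Lead (n • l) (f ^ n) (p ^ n) := by
  induction n with
  | zero => simpa using Lead.one
  | succ n ih => rw [pow_succ, pow_succ, succ_nsmul]; exact ih.mul h

lemma Lead.coeff {l : Dual ℂ H} {f : GAlg H} {p : MvPolynomial ι ℂ} (h : D.Lead l f p)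
    (b : ι →₀ ℕ) : f.coeff (l + D.psi b) = p.coeff b := by
  rw [h.1, ex_mul_coeff, phi_coeff]

lemma Lead.exists_psi {l : Dual ℂ H} {f : GAlg H} {p : MvPolynomial ι ℂ} (h : D.Lead l f p)
    (μ : Dual ℂ H) (hμ : f.coeff μ ≠ 0) : ∃ b, μ = l + D.psi b := by
  rw [h.1, show μ = l + (μ - l) by abel, ex_mul_coeff] at hμ
  obtain ⟨b, hb⟩ := D.phi_coeff_ne p _ hμ
  exact ⟨b, by rw [← hb]; abel⟩

lemma Lead.coeff_self {l : Dual ℂ H} {f : GAlg H} {p : MvPolynomial ι ℂ} (h : D.Lead l f p) :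
    f.coeff l = 1 := by
  have := h.coeff 0
  rw [map_zero, add_zero] at this
  rw [this, ← h.2]; rfl

lemma Lead.unique {l l' : Dual ℂ H} {f : GAlg H} {p p' : MvPolynomial ι ℂ} (h : D.Lead l f p)
    (h' : D.Lead l' f p') : l = l' ∧ p = p' := by
  obtain ⟨b, hb⟩ := h.exists_psi l' (by rw [h'.coeff_self]; exact one_ne_zero)
  obtain ⟨b', hb'⟩ := h'.exists_psi l (by rw [h.coeff_self]; exact one_ne_zero)
  have e : D.psi (b + b') = D.psi 0 := by
    rw [map_add, map_zero]
    rw [hb, add_assoc] at hb'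
    simpa using hb'
  have e2 := D.psi_inj e
  have e3 : b = 0 := by
    ext i
    have := DFunLike.congr_fun e2 i
    simp at this
    simp; omega
  have hl : l = l' := by rw [hb, e3, map_zero, add_zero]
  subst hl
  refine ⟨rfl, ?_⟩
  ext b
  rw [← h.coeff, ← h'.coeff]

lemma Lead.of_supp {l : Dual ℂ H} {f : GAlg H} (h1 : f.coeff l = 1)
    (h2 : ∀ μ, f.coeff μ ≠ 0 → ∃ b, μ = l + D.psi b) : ∃ p, D.Lead l f p := by
  have h3 : ↑(ex (-l) * f).coeff.support ⊆ Set.range D.psi := by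
    intro μ hμ
    rw [Finset.mem_coe, Finsupp.mem_support_iff, show μ = -l + (l + μ) by abel, ex_mul_coeff] at hμ
    obtain ⟨b, hb⟩ := h2 _ hμ
    exact ⟨b, (add_left_cancel hb).symm⟩
  have h4 := AddMonoidAlgebra.mapDomain_comapDomain h3 D.psi_inj
  set p : MvPolynomial ι ℂ := AddMonoidAlgebra.comapDomain D.psi D.psi_inj (ex (-l) * f) with hp
  have h5 : D.phi p = ex (-l) * f := h4
  have h6 : f = ex l * D.phi p := by
    rw [h5, ← mul_assoc, ← ex_add, add_neg_cancel, ex_zero, one_mul]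
  refine ⟨p, h6, ?_⟩
  have := D.phi_coeff p 0
  rw [map_zero, h5, show (0 : Dual ℂ H) = -l + l by simp, ex_mul_coeff, h1] at this
  rw [this]; rfl

variable (D) in
lemma lead_Q : ∃ p, D.Lead D.rho D.Q p := by
  choose! n hn using D.Pcomb
  refine ⟨_, Lead.prod D.P _ _ (fun α => 1 - MvPolynomial.monomial (n α) 1) ?_⟩
  intro α hα
  obtain ⟨h0, h1⟩ := hn α hα
  constructor
  · rw [map_sub, map_one, phi_monomial, mul_sub, mul_one, ← ex_add]
    congr 2
    rw [psi_apply, ← h1]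
    module
  · rw [map_sub, map_one, MvPolynomial.constantCoeff_monomial, if_neg h0, sub_zero]

/-- The skew function attached to a leading term. -/
noncomputable def uu (D : CD H ι) (l : Dual ℂ H) (f : GAlg H) (b : ι → ℤ) : ℂ :=
  f.coeff (l - D.beta b)

lemma Lead.ser {l : Dual ℂ H} {f : GAlg H} {p : MvPolynomial ι ℂ} (h : D.Lead l f p) :
    SkewData.ser (D.uu l f) = (p : MvPowerSeries ι ℂ) := by
  ext b
  rw [SkewData.coeff_ser, MvPolynomial.coeff_coe, ← h.coeff, uu, psi_eq, sub_eq_add_neg]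

lemma Lead.skew {l : Dual ℂ H} {f : GAlg H} {p : MvPolynomial ι ℂ} (h : D.Lead l f p)
    (k : ι →₀ ℕ) (hk : ∀ i, l (D.hc i) = k i) (hk0 : ∀ i, 0 < k i)
    (hf : ∀ i, D.sig i f = - f)
    (hdom : ∀ b : ι → ℤ, (∀ i, 0 ≤ b i) → f.coeff (l - D.beta b) ≠ 0 →
      (∀ j, 0 < cc D.A k b j) → b = 0) : SkewData D.A k (D.uu l f) := by
  have hnn : ∀ (b : ι → ℤ), D.uu l f b ≠ 0 → ∀ i, 0 ≤ b i := by
    intro b hb i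
    obtain ⟨b', hb'⟩ := h.exists_psi _ hb
    rw [psi_eq, sub_eq_add_neg] at hb'
    have := D.beta_inj (neg_inj.1 (add_left_cancel hb'))
    rw [this]; positivity
  refine ⟨D.diag, D.off, D.zero, hk0, hnn, ?_, ?_, ?_⟩
  · have : D.beta 0 = 0 := by simp [beta]
    rw [uu, this, sub_zero, h.coeff_self]
  · intro b j
    have e : l - D.beta (b + Pi.single j (cc D.A k b j)) = D.s j (l - D.beta b) := by
      rw [beta_add, beta_single, s_apply]
      have : (l - D.beta b) (D.hc j) = (cc D.A k b j : ℂ) := by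
        rw [LinearMap.sub_apply, hk, beta_hc]; unfold cc; push_cast; rfl
      rw [this]; abel
    have h1 := D.sig_coeff j f (l - D.beta b)
    rw [hf] at h1
    rw [uu, uu, e, ← h1]
    simp
  · intro b hb hh
    exact hdom b (hnn b hb) hb hh

variable (D) in
lemma skew_Q : SkewData D.A (Finsupp.equivFunOnFinite.symm fun _ => 1) (D.uu D.rho D.Q) := by
  obtain ⟨p, hp⟩ := D.lead_Q
  apply hp.skew
  · intro i; rw [rho_hc]; simp
  · intro i; simp
  · exact D.sig_Q
  · intro b hb _ hh
    apply D.dom_Q b hb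
    intro j
    have := hh j
    unfold cc at this
    simp at this
    omega

variable (D) in
lemma Lap_Q : D.Lap D.Q = D.B D.rho D.rho • D.Q := by
  obtain ⟨p, hp⟩ := D.lead_Q
  ext μ
  unfold Lap
  rw [coeff_op, AddMonoidAlgebra.coeff_smul, Finsupp.smul_apply, smul_eq_mul]
  by_cases h : D.Q.coeff μ = 0
  · rw [h]; simp
  congr 1
  obtain ⟨b, rfl⟩ := hp.exists_psi μ h
  have := D.skew_Q.const (fun b => D.B (D.rho - D.beta b) (D.rho - D.beta b)) ?_
    (fun i => (b i : ℤ)) ?_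
  · rw [psi_eq, ← sub_eq_add_neg, this]
    simp [beta]
  · intro b j
    rw [← D.B_s j (D.rho - D.beta b)]
    have e : D.rho - D.beta (b + Pi.single j (cc D.A (Finsupp.equivFunOnFinite.symm fun _ => 1) b j))
        = D.s j (D.rho - D.beta b) := by
      rw [beta_add, beta_single, s_apply]
      have : (D.rho - D.beta b) (D.hc j) =
          (cc D.A (Finsupp.equivFunOnFinite.symm fun _ => 1) b j : ℂ) := by
        rw [LinearMap.sub_apply, rho_hc, beta_hc]; unfold cc; push_cast; simp
      rw [this]; abel
    rw [e]
  · rw [uu, sub_eq_add_neg, ← psi_eq]; exact h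

/-- Abstract consequence of the Casimir operator acting by a scalar. -/
structure IsChar (D : CD H ι) (l : Dual ℂ H) (m : ι →₀ ℕ) (ch : GAlg H) : Prop where
  lead : ∃ p, D.Lead l ch p
  inv : ∀ i, D.sig i ch = ch
  wt : ∀ i, l (D.hc i) = m i
  cas : ∃ (c : ℂ) (T : Dual ℂ H → GAlg H),
    c • ch = D.Lap ch + ∑ α ∈ D.P, (1 + ex (-α)) * T α ∧
    ∀ α ∈ D.P, (1 - ex (-α)) * T α = der (D.t α) ch

lemma IsChar.lap {l : Dual ℂ H} {m : ι →₀ ℕ} {ch : GAlg H} (h : D.IsChar l m ch) :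
    ∃ c : ℂ, D.Lap (D.Q * ch) = c • (D.Q * ch) := by
  obtain ⟨c, T, h1, h2⟩ := h.cas
  refine ⟨D.B D.rho D.rho + c, ?_⟩
  classical
  have h3 : (2 : ℂ) • ∑ j, der (D.u j) D.Q * der (D.u' j) ch =
      D.Q * ∑ α ∈ D.P, (1 + ex (-α)) * T α := by
    have e1 : ∀ α : Dual ℂ H, ex (-((1 / 2 : ℂ) • α)) = ex ((1 / 2 : ℂ) • α) * ex (-α) := by
      intro α; rw [← ex_add]; congr 1; module
    have e2 : ∀ (α : Dual ℂ H) (x : H), der x (ex ((1 / 2 : ℂ) • α) - ex (-((1 / 2 : ℂ) • α))) =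
        (1 / 2 * α x) • (ex ((1 / 2 : ℂ) • α) * (1 + ex (-α))) := by
      intro α x
      rw [map_sub, der_ex, der_ex, mul_add, mul_one, ← e1, smul_add]
      simp [sub_eq_add_neg]
    have e3 : ∀ α, ∑ j, α (D.u j) • der (D.u' j) ch = der (D.t α) ch := by
      intro α
      ext μ
      simp only [AddMonoidAlgebra.coeff_sum, Finsupp.finsetSum_apply, AddMonoidAlgebra.coeff_smul,
        Finsupp.smul_apply, der, coeff_op, smul_eq_mul, D.ht, D.hB, Finset.sum_mul]
      exact Finset.sum_congr rfl fun j _ => by ring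
    have e4 : ∀ j, der (D.u j) D.Q * der (D.u' j) ch = ∑ α ∈ D.P,
        (1 / 2 : ℂ) • ((∏ β ∈ D.P.erase α, (ex ((1 / 2 : ℂ) • β) - ex (-((1 / 2 : ℂ) • β)))) *
        (ex ((1 / 2 : ℂ) • α) * (1 + ex (-α))) * (α (D.u j) • der (D.u' j) ch)) := by
      intro j
      unfold Q
      rw [der_prod, Finset.sum_mul]
      apply Finset.sum_congr rfl
      intro α _
      rw [e2]
      simp only [mul_smul_comm, smul_mul_assoc, smul_smul]
    simp only [e4]
    rw [Finset.sum_comm, Finset.smul_sum, Finset.mul_sum]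
    apply Finset.sum_congr rfl
    intro α hα
    rw [← Finset.smul_sum, ← Finset.mul_sum, e3, smul_smul, ← h2 α hα]
    unfold Q
    rw [← Finset.mul_prod_erase _ _ hα, e1 α]
    norm_num
    ring
  rw [D.Lap_mul, Lap_Q, h3, add_assoc, ← mul_add, add_smul, ← mul_smul_comm c, h1]
  rw [smul_mul_assoc]

theorem IsChar.skew {l : Dual ℂ H} {m : ι →₀ ℕ} {ch : GAlg H} (h : D.IsChar l m ch) :
    SkewData D.A (m + Finsupp.equivFunOnFinite.symm fun _ => 1) (D.uu (D.rho + l) (D.Q * ch)) := by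
  obtain ⟨p, hp⟩ := h.lead
  obtain ⟨q, hq⟩ := D.lead_Q
  have hL := hq.mul hp
  obtain ⟨c, hc⟩ := h.lap
  have hcoef : ∀ μ, (D.Q * ch).coeff μ ≠ 0 → D.B μ μ = c := by
    intro μ hμ
    have := congrArg (fun f => f.coeff μ) hc
    simp only [Lap] at this
    rw [coeff_op, AddMonoidAlgebra.coeff_smul, Finsupp.smul_apply, smul_eq_mul] at this
    exact mul_right_cancel₀ hμ this
  have hk : ∀ i, (D.rho + l) (D.hc i) =
      ((m + Finsupp.equivFunOnFinite.symm fun _ => 1 : ι →₀ ℕ) i : ℂ) := by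
    intro i; rw [LinearMap.add_apply, rho_hc, h.wt]; simp; ring
  apply hL.skew
  · exact hk
  · intro i; simp
  · intro i; rw [map_mul, sig_Q, h.inv]; ring
  · intro b hb hne hh
    apply D.dom_V b hb (D.rho + l) _ hk _ hh
    rw [hcoef _ hne, hcoef _ (by rw [hL.coeff_self]; exact one_ne_zero)]

end CD
end GA
end UFT

set_option linter.unusedSectionVars false
namespace UFT
section Fin

open Module CD

lemma exists_equiv_of_map_eq {α β X : Type} [Fintype α] [Fintype β] (f : α → X) (g : β → X)
    (h : (Finset.univ : Finset α).val.map f = (Finset.univ : Finset β).val.map g) :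
    ∃ σ : α ≃ β, ∀ i, f i = g (σ i) := by
  classical
  have h1 : ∀ x, Nonempty ({a // f a = x} ≃ {b // g b = x}) := by
    intro x
    have h2 := congrArg (Multiset.count x) h
    rw [Multiset.count_map, Multiset.count_map] at h2
    apply Fintype.card_eq.1
    rw [Fintype.card_subtype, Fintype.card_subtype]
    simp only [eq_comm (a := x)] at h2
    exact h2
  have e := fun x => Classical.choice (h1 x)
  exact ⟨Equiv.ofFiberEquiv e, fun i => (Equiv.ofFiberEquiv_map e i).symm⟩

variable {H : Type} [AddCommGroup H] [Module ℂ H] {ι : Type} [Fintype ι] [DecidableEq ι]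

open Classical in
/-- The universal series attached to an exponent. -/
noncomputable def Pf (A : ι → ι → ℤ) (k : ι →₀ ℕ) : MvPowerSeries ι ℂ :=
  if h : ∃ u, SkewData A k u then SkewData.ser h.choose else 0

lemma Pf_eq {A : ι → ι → ℤ} {k : ι →₀ ℕ} {u : (ι → ℤ) → ℂ} (h : SkewData A k u) :
    Pf A k = SkewData.ser u := by
  have h1 : ∃ u, SkewData A k u := ⟨u, h⟩
  unfold Pf
  rw [dif_pos h1, SkewData.unique h1.choose_spec h]

theorem chars_unique (D : CD H ι) {n m : ℕ} (l : Fin n → Dual ℂ H) (l' : Fin m → Dual ℂ H)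
    (k : Fin n → (ι →₀ ℕ)) (k' : Fin m → (ι →₀ ℕ)) (ch : Fin n → GAlg H) (ch' : Fin m → GAlg H)
    (h : ∀ i, D.IsChar (l i) (k i) (ch i)) (h' : ∀ j, D.IsChar (l' j) (k' j) (ch' j))
    (hk : ∀ i, k i ≠ 0) (hk' : ∀ j, k' j ≠ 0) (heq : ∏ i, ch i = ∏ j, ch' j) :
    ∃ σ : Fin n ≃ Fin m, ∀ i, k i = k' (σ i) := by
  classical
  obtain ⟨q, hq⟩ := D.lead_Q
  choose p hp using fun i => (h i).lead
  choose p' hp' using fun i => (h' i).lead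
  set one : ι →₀ ℕ := Finsupp.equivFunOnFinite.symm fun _ => 1 with hone
  have e1 := (Lead.prod Finset.univ _ _ _ (fun i _ => hq.mul (hp i))).mul (hq.pow m)
  have e2 := (Lead.prod Finset.univ _ _ _ (fun i _ => hq.mul (hp' i))).mul (hq.pow n)
  have e3 : (∏ i, (D.Q * ch i)) * D.Q ^ m = (∏ j, (D.Q * ch' j)) * D.Q ^ n := by
    rw [Finset.prod_mul_distrib, Finset.prod_mul_distrib, heq]
    simp; ring
  rw [e3] at e1
  have e4 := (e1.unique e2).2
  have e5 := congrArg (MvPolynomial.coeToMvPowerSeries.ringHom (σ := ι) (R := ℂ)) e4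
  rw [map_mul, map_mul, map_prod, map_prod, map_pow, map_pow] at e5
  have hQ : MvPolynomial.coeToMvPowerSeries.ringHom q = Pf D.A one := by
    rw [Pf_eq D.skew_Q, hq.ser]; rfl
  have h1 : ∀ i, MvPolynomial.coeToMvPowerSeries.ringHom (q * p i) = Pf D.A (k i + one) := by
    intro i
    rw [Pf_eq (h i).skew, (hq.mul (hp i)).ser]; rfl
  have h1' : ∀ i, MvPolynomial.coeToMvPowerSeries.ringHom (q * p' i) = Pf D.A (k' i + one) := by
    intro i
    rw [Pf_eq (h' i).skew, (hq.mul (hp' i)).ser]; rfl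
  simp only [h1, h1', hQ] at e5
  have key := multiset_eq_of_prod (adj := SkewData.dadj D.A) (D.skew_Q.dadj_symm)
    (fun x hx => hx.1 rfl) D.v0 D.conn (Pf D.A)
    ((Finset.univ : Finset (Fin n)).val.map (fun i => k i + one) + Multiset.replicate m one)
    ((Finset.univ : Finset (Fin m)).val.map (fun i => k' i + one) + Multiset.replicate n one)
    ?_ ?_ ?_
  · have key2 := congrArg (Multiset.filter (fun x => x ≠ one)) key
    rw [Multiset.filter_add, Multiset.filter_add] at key2
    have r1 : ∀ N, Multiset.filter (fun x => x ≠ one) (Multiset.replicate N one) = 0 := by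
      intro N
      rw [Multiset.filter_eq_nil]
      intro a ha
      rw [Multiset.eq_of_mem_replicate ha]; simp
    rw [r1, r1, add_zero, add_zero, Multiset.filter_eq_self.2, Multiset.filter_eq_self.2] at key2
    · obtain ⟨σ, hσ⟩ := exists_equiv_of_map_eq _ _ key2
      exact ⟨σ, fun i => add_right_cancel (hσ i)⟩
    · intro a ha
      obtain ⟨i, _, rfl⟩ := Multiset.mem_map.1 ha
      simpa using hk' i
    · intro a ha
      obtain ⟨i, _, rfl⟩ := Multiset.mem_map.1 ha
      simpa using hk i
  · intro x hx
    rcases Multiset.mem_add.1 hx with hx | hx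
    · obtain ⟨i, _, rfl⟩ := Multiset.mem_map.1 hx
      rw [Pf_eq (h i).skew]; exact (h i).skew.good
    · rw [Multiset.eq_of_mem_replicate hx, Pf_eq D.skew_Q]; exact D.skew_Q.good
  · intro x hx
    rcases Multiset.mem_add.1 hx with hx | hx
    · obtain ⟨i, _, rfl⟩ := Multiset.mem_map.1 hx
      rw [Pf_eq (h' i).skew]; exact (h' i).skew.good
    · rw [Multiset.eq_of_mem_replicate hx, Pf_eq D.skew_Q]; exact D.skew_Q.good
  · rw [Multiset.map_add, Multiset.map_add, Multiset.prod_add, Multiset.prod_add,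
      Multiset.map_replicate, Multiset.map_replicate, Multiset.prod_replicate,
      Multiset.prod_replicate, Multiset.map_map, Multiset.map_map]
    exact e5

end Fin
end UFT

set_option linter.unusedSectionVars false
namespace UFT
section RDsec

open Module
open scoped TensorProduct

/-- Root data of a Lie algebra: a Cartan subspace, root vectors, and the Casimir tensor. -/
structure RD (g : Type) [LieRing g] [LieAlgebra ℂ g] (H : Type) [AddCommGroup H] [Module ℂ H]
    (ι : Type) [Fintype ι] [DecidableEq ι] extends CD H ι where
  em : H →ₗ[ℂ] g
  abel : ∀ h h' : H, ⁅em h, em h'⁆ = 0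
  x : Dual ℂ H → g
  y : Dual ℂ H → g
  hx : ∀ α ∈ P, ∀ h : H, ⁅em h, x α⁆ = α h • x α
  hy : ∀ α ∈ P, ∀ h : H, ⁅em h, y α⁆ = -(α h) • y α
  span : ∀ S : Submodule ℂ g, (∀ h : H, em h ∈ S) → (∀ α ∈ P, x α ∈ S) → (∀ α ∈ P, y α ∈ S) → S = ⊤
  hxy : ∀ α ∈ P, ⁅x α, y α⁆ = em (t α)
  c : Dual ℂ H → ℂ
  sl2 : ∀ α ∈ P, IsSl2Triple (c α • em (t α)) (x α) (c α • y α)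
  hc_eq : ∀ i, hc i = c (a i) • t (a i)
  cas : ∀ z : g, ⁅z, ∑ j, em (u j) ⊗ₜ[ℂ] em (u' j) + ∑ α ∈ P, (x α ⊗ₜ[ℂ] y α + y α ⊗ₜ[ℂ] x α)⁆ = 0
  wtex : ∀ (M : Type) [AddCommGroup M] [Module ℂ M] [LieRingModule g M] [LieModule ℂ g M]
    [FiniteDimensional ℂ M] [Nontrivial M], ∃ (μ : Dual ℂ H) (v : M), v ≠ 0 ∧
      ∀ h : H, ⁅em h, v⁆ = μ h • v

variable {g : Type} [LieRing g] [LieAlgebra ℂ g] {H : Type} [AddCommGroup H] [Module ℂ H]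
  {ι : Type} [Fintype ι] [DecidableEq ι]

namespace RD

variable (D : RD g H ι)
variable {M : Type} [AddCommGroup M] [Module ℂ M] [LieRingModule g M] [LieModule ℂ g M]
variable {N : Type} [AddCommGroup N] [Module ℂ N] [LieRingModule g N] [LieModule ℂ g N]

variable (M) in
/-- weight space -/
def wtS (μ : Dual ℂ H) : Submodule ℂ M where
  carrier := {v | ∀ h : H, ⁅D.em h, v⁆ = μ h • v}
  add_mem' := by
    intro a b ha hb h
    rw [lie_add, ha h, hb h, smul_add]
  zero_mem' := by intro h; simp
  smul_mem' := by
    intro c v hv h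
    rw [lie_smul, hv h, smul_comm]

lemma mem_wtS {μ : Dual ℂ H} {v : M} : v ∈ D.wtS M μ ↔ ∀ h : H, ⁅D.em h, v⁆ = μ h • v := Iff.rfl

lemma wt_indep (s : Finset (Dual ℂ H)) : ∀ v : Dual ℂ H → M, (∀ μ ∈ s, v μ ∈ D.wtS M μ) →
    ∑ μ ∈ s, v μ = 0 → ∀ μ ∈ s, v μ = 0 := by
  classical
  induction s using Finset.induction_on with
  | empty => simp
  | insert ν s hν ih =>
    intro v hv h0
    have key : ∀ μ ∈ s, v μ = 0 := by
      intro μ hμ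
      have hne : μ ≠ ν := fun h => hν (h ▸ hμ)
      obtain ⟨h, hh⟩ : ∃ h, μ h ≠ ν h := by
        by_contra hcon
        push Not at hcon
        exact hne (LinearMap.ext hcon)
      have := ih (fun μ => (μ h - ν h) • v μ)
        (fun μ hμ => Submodule.smul_mem _ _ (hv μ (Finset.mem_insert_of_mem hμ))) ?_ μ hμ
      · exact (smul_eq_zero.1 this).resolve_left (sub_ne_zero.2 hh)
      · have e1 : ⁅D.em h, ∑ μ ∈ insert ν s, v μ⁆ = ∑ μ ∈ insert ν s, μ h • v μ := by
          rw [lie_sum]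
          exact Finset.sum_congr rfl fun μ hμ => hv μ hμ h
        rw [h0, lie_zero] at e1
        have e2 : ∑ μ ∈ insert ν s, (μ h - ν h) • v μ = 0 := by
          simp only [sub_smul, Finset.sum_sub_distrib]
          rw [← e1, ← Finset.smul_sum, h0]; simp
        rw [Finset.sum_insert hν] at e2
        simpa using e2
    intro μ hμ
    rcases Finset.mem_insert.1 hμ with rfl | hμ
    · rw [Finset.sum_insert hν, Finset.sum_eq_zero key, add_zero] at h0
      exact h0
    · exact key μ hμ

lemma wts_finite [FiniteDimensional ℂ M] : {μ : Dual ℂ H | ∃ v ∈ D.wtS M μ, v ≠ 0}.Finite := by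
  classical
  choose v hv hv0 using fun μ : {μ : Dual ℂ H | ∃ v ∈ D.wtS M μ, v ≠ 0} => μ.2
  have : LinearIndependent ℂ v := by
    rw [linearIndependent_iff']
    intro s c hc i hi
    have := D.wt_indep (M := M) (s.map ⟨Subtype.val, Subtype.val_injective⟩)
      (fun μ => if h : μ ∈ {μ : Dual ℂ H | ∃ v ∈ D.wtS M μ, v ≠ 0} then c ⟨μ, h⟩ • v ⟨μ, h⟩ else 0)
      ?_ ?_ i.1 (by simpa using hi)
    · have h2 := i.2
      rw [dif_pos h2] at this
      exact (smul_eq_zero.1 this).resolve_right (hv0 _)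
    · intro μ _
      split_ifs with h
      · exact Submodule.smul_mem _ _ (hv _)
      · exact zero_mem _
    · rw [Finset.sum_map]
      refine Eq.trans ?_ hc
      refine Finset.sum_congr rfl fun i _ => ?_
      have h2 := i.2
      simp only [Function.Embedding.coeFn_mk]
      rw [dif_pos h2]
  have := this.finite
  exact Set.toFinite _

lemma shift_x {α : Dual ℂ H} (hα : α ∈ D.P) {μ : Dual ℂ H} {v : M} (hv : v ∈ D.wtS M μ) :
    ⁅D.x α, v⁆ ∈ D.wtS M (μ + α) := by
  intro h
  rw [leibniz_lie, D.hx α hα, hv h, smul_lie, lie_smul, ← add_smul]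
  simp [add_comm]

lemma shift_y {α : Dual ℂ H} (hα : α ∈ D.P) {μ : Dual ℂ H} {v : M} (hv : v ∈ D.wtS M μ) :
    ⁅D.y α, v⁆ ∈ D.wtS M (μ - α) := by
  intro h
  rw [leibniz_lie, D.hy α hα, hv h, smul_lie, lie_smul, ← add_smul]
  simp [add_comm, sub_eq_add_neg]

lemma wtS_map (e : M →ₗ⁅ℂ,g⁆ N) {μ : Dual ℂ H} {v : M} (hv : v ∈ D.wtS M μ) : e v ∈ D.wtS N μ := by
  intro h
  rw [← LieModuleHom.map_lie, hv h, map_smul]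

/-- Weight decomposition data. -/
structure WB (κ : Type) (b : Basis κ ℂ M) (w : κ → Dual ℂ H) : Prop where
  wt : ∀ i, b i ∈ D.wtS M (w i)

lemma WB.coord {κ : Type} [Fintype κ] {b : Basis κ ℂ M} {w : κ → Dual ℂ H} (h : D.WB κ b w)
    {μ : Dual ℂ H} {v : M} (hv : v ∈ D.wtS M μ) (i : κ) (hi : w i ≠ μ) : b.repr v i = 0 := by
  obtain ⟨t, ht⟩ : ∃ t, w i t ≠ μ t := by
    by_contra hcon
    push Not at hcon
    exact hi (LinearMap.ext hcon)
  have h1 := hv t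
  conv_lhs at h1 => rw [← b.sum_repr v, lie_sum]
  have h2 : ∑ j, ⁅D.em t, b.repr v j • b j⁆ = ∑ j, (b.repr v j * w j t) • b j := by
    refine Finset.sum_congr rfl fun j _ => ?_
    rw [lie_smul, h.wt j t, smul_smul]
  rw [h2] at h1
  have h3 := congrArg (fun z => b.repr z i) h1
  simp only [b.repr_sum_self, map_smul, Finsupp.smul_apply, smul_eq_mul] at h3
  have h4 : b.repr v i * (w i t - μ t) = 0 := by linear_combination h3
  exact (mul_eq_zero.1 h4).resolve_right (sub_ne_zero.2 ht)

variable (M) in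
/-- `f` is the formal character of `M`. -/
def HasChar (f : GAlg H) : Prop :=
  ∃ (κ : Type) (_ : Fintype κ) (b : Basis κ ℂ M) (w : κ → Dual ℂ H), D.WB κ b w ∧ f = ∑ i, ex (w i)

open Classical in
lemma ch_coeff {κ : Type} [Fintype κ] (w : κ → Dual ℂ H) (μ : Dual ℂ H) :
    (∑ i, ex (w i) : GAlg H).coeff μ = ((Finset.univ.filter fun i => w i = μ).card : ℂ) := by
  rw [AddMonoidAlgebra.coeff_sum, Finsupp.finsetSum_apply, Finset.card_filter]
  push_cast
  refine Finset.sum_congr rfl fun i _ => ?_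
  simp [ex, Finsupp.single_apply]

lemma WB.coeff {κ : Type} [Fintype κ] {b : Basis κ ℂ M} {w : κ → Dual ℂ H} (h : D.WB κ b w)
    (μ : Dual ℂ H) : (∑ i, ex (w i) : GAlg H).coeff μ = (finrank ℂ (D.wtS M μ) : ℂ) := by
  classical
  rw [ch_coeff]
  have : D.wtS M μ = Submodule.span ℂ (Set.range fun i : {i // w i = μ} => b i.1) := by
    apply le_antisymm
    · intro v hv
      rw [← b.sum_repr v]
      refine Submodule.sum_mem _ fun i _ => ?_
      by_cases hi : w i = μ
      · exact Submodule.smul_mem _ _ (Submodule.subset_span ⟨⟨i, hi⟩, rfl⟩)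
      · rw [h.coord D hv i hi, zero_smul]; exact zero_mem _
    · rw [Submodule.span_le]
      rintro _ ⟨⟨i, rfl⟩, rfl⟩
      exact h.wt i
  rw [this, finrank_span_eq_card, Fintype.card_subtype]
  exact b.linearIndependent.comp _ Subtype.val_injective

lemma HasChar.unique {f f' : GAlg H} (h : D.HasChar M f) (h' : D.HasChar M f') : f = f' := by
  obtain ⟨κ, _, b, w, hw, rfl⟩ := h
  obtain ⟨κ', _, b', w', hw', rfl⟩ := h'
  ext μ
  rw [hw.coeff, hw'.coeff]

lemma HasChar.map {f : GAlg H} (h : D.HasChar M f) (e : M ≃ₗ⁅ℂ,g⁆ N) : D.HasChar N f := by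
  obtain ⟨κ, _, b, w, hw, rfl⟩ := h
  refine ⟨κ, inferInstance, b.map e.toLinearEquiv, w, ⟨fun i => ?_⟩, rfl⟩
  exact D.wtS_map e.toLieModuleHom (hw.wt i)

lemma HasChar.tensor {f f' : GAlg H} (h : D.HasChar M f) (h' : D.HasChar N f') :
    D.HasChar (M ⊗[ℂ] N) (f * f') := by
  obtain ⟨κ, _, b, w, hw, rfl⟩ := h
  obtain ⟨κ', _, b', w', hw', rfl⟩ := h'
  refine ⟨κ × κ', inferInstance, b.tensorProduct b', fun p => w p.1 + w' p.2, ⟨fun p t => ?_⟩, ?_⟩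
  · rw [Basis.tensorProduct_apply, TensorProduct.LieModule.lie_tmul_right, hw.wt p.1 t,
      hw'.wt p.2 t, LinearMap.add_apply, add_smul, TensorProduct.smul_tmul', TensorProduct.tmul_smul]
  · rw [Finset.sum_mul_sum, Fintype.sum_prod_type]
    simp [ex_add]

/-! ### words -/

/-- words in lowering operators -/
inductive Wd (v : M) : (ι →₀ ℕ) → M → Prop
  | base : Wd v 0 v
  | step (α : Dual ℂ H) (hα : α ∈ D.P) (n : ι →₀ ℕ) (hn : n ≠ 0) (hn' : α = ∑ i, (n i : ℂ) • D.a i)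
    (b : ι →₀ ℕ) (w : M) : Wd v b w → Wd v (b + n) ⁅D.y α, w⁆

/-- highest weight vector -/
structure HW (l : Dual ℂ H) (v : M) : Prop where
  wt : v ∈ D.wtS M l
  kill : ∀ α ∈ D.P, ⁅D.x α, v⁆ = 0

lemma Wd.wt {l : Dual ℂ H} {v : M} (h : v ∈ D.wtS M l) {b : ι →₀ ℕ} {w : M} (hw : D.Wd v b w) :
    w ∈ D.wtS M (l + D.psi b) := by
  induction hw with
  | base => simpa using h
  | step α hα n hn hn' b w _ ih =>
    have := D.shift_y hα ih
    rw [map_add, D.psi_apply n, ← hn']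
    convert this using 2
    abel

lemma Wd.zero {v : M} {w : M} {b : ι →₀ ℕ} (hw : D.Wd v b w) (hb : b = 0) : w = v := by
  cases hw with
  | base => rfl
  | step α hα n hn hn' b w _ => simp at hb; exact absurd hb.2 hn

/-- span of the words as Lie submodule -/
lemma wd_stable {l : Dual ℂ H} {v : M} (h : D.HW l v) :
    ∃ S : LieSubmodule ℂ g M, (S : Submodule ℂ M) = Submodule.span ℂ {w | ∃ b, D.Wd v b w} := by
  set S := Submodule.span ℂ {w | ∃ b, D.Wd v b w} with hS
  have hyS : ∀ α ∈ D.P, ∀ w ∈ S, ⁅D.y α, w⁆ ∈ S := by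
    intro α hα w hw
    obtain ⟨n, hn, hn'⟩ := D.Pcomb α hα
    have : S ≤ S.comap (LieModule.toEnd ℂ g M (D.y α)) := by
      rw [hS, Submodule.span_le]
      rintro w ⟨b, hb⟩
      exact Submodule.subset_span ⟨b + n, Wd.step α hα n hn hn' b w hb⟩
    exact this hw
  have key : ∀ b w, D.Wd v b w → ∀ z : g, ⁅z, w⁆ ∈ S := by
    intro b w hw
    induction hw with
    | base =>
      intro z
      have htop := D.span (S.comap ((LieModule.toEnd ℂ g M : g →ₗ[ℂ] End ℂ M).flip v)) ?_ ?_ ?_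
      · have : z ∈ (⊤ : Submodule ℂ g) := trivial
        rw [← htop] at this
        exact this
      · intro t
        change ⁅D.em t, v⁆ ∈ S
        rw [h.wt t]
        exact Submodule.smul_mem _ _ (Submodule.subset_span ⟨0, Wd.base⟩)
      · intro α hα
        change ⁅D.x α, v⁆ ∈ S
        rw [h.kill α hα]; exact zero_mem _
      · intro α hα
        exact hyS α hα v (Submodule.subset_span ⟨0, Wd.base⟩)
    | step α hα n hn hn' b w _ ih =>
      intro z
      rw [leibniz_lie]
      exact add_mem (ih _) (hyS α hα _ (ih z))
  refine ⟨{ S with lie_mem := ?_ }, rfl⟩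
  intro z w hw
  have : S ≤ S.comap (LieModule.toEnd ℂ g M z) := by
    conv_lhs => rw [hS]
    rw [Submodule.span_le]
    rintro w ⟨b, hb⟩
    exact key b w hb z
  exact this hw

/-- `v` generates `M` -/
def Cyc (g : Type) [LieRing g] [LieAlgebra ℂ g] {M : Type} [AddCommGroup M] [Module ℂ M]
    [LieRingModule g M] [LieModule ℂ g M] (v : M) : Prop :=
  v ≠ 0 ∧ ∀ S : LieSubmodule ℂ g M, v ∈ S → S = ⊤

lemma wd_basis [FiniteDimensional ℂ M] {l : Dual ℂ H} {v : M} (h : D.HW l v) (hc : Cyc g v) :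
    ∃ (κ : Type) (_ : Fintype κ) (b : Basis κ ℂ M) (d : κ → (ι →₀ ℕ)) (i0 : κ),
      D.WB κ b (fun i => l + D.psi (d i)) ∧ b i0 = v ∧ d i0 = 0 ∧ ∀ i, d i = 0 → i = i0 := by
  obtain ⟨S, hS⟩ := D.wd_stable h
  have hvS : v ∈ S := by
    have : v ∈ (S : Submodule ℂ M) := by
      rw [hS]; exact Submodule.subset_span ⟨0, Wd.base⟩
    exact this
  have htop := hc.2 S hvS
  have hli : LinearIndepOn ℂ id ({v} : Set M) := LinearIndepOn.singleton (v := id) hc.1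
  have hst : ({v} : Set M) ⊆ {w | ∃ b, D.Wd v b w} := by
    rintro _ rfl; exact ⟨0, Wd.base⟩
  have hsp : ⊤ ≤ Submodule.span ℂ {w | ∃ b, D.Wd v b w} := by
    rw [← hS, htop]; simp
  let B := Basis.extendLe hli hst hsp
  have hB : ∀ i, ∃ b, D.Wd v b (B i) := fun i => by
    have := Basis.extendLe_subset hli hst hsp
    have h2 := this (Set.mem_range_self i)
    exact h2
  choose d hd using hB
  obtain ⟨i0, hi0⟩ : v ∈ Set.range B := Basis.subset_extendLe hli hst hsp rfl
  have hfin : Fintype (hli.extend hst) := FiniteDimensional.fintypeBasisIndex B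
  have hone : ∀ i, d i = 0 → i = i0 := fun i hi => B.injective (by rw [hi0]; exact (hd i).zero D hi)
  refine ⟨_, hfin, B, d, i0, ⟨fun i => (hd i).wt D h.wt⟩, hi0, ?_, hone⟩
  have h1 := (hd i0).wt D h.wt
  rw [hi0] at h1
  by_contra hne
  have hp : D.psi (d i0) ≠ 0 := fun h0 => hne (D.psi_inj (by rw [h0, map_zero]))
  obtain ⟨t, ht⟩ : ∃ t, D.psi (d i0) t ≠ 0 := by
    by_contra hcon
    push Not at hcon
    exact hp (LinearMap.ext hcon)
  have h2 := h1 t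
  rw [h.wt t, LinearMap.add_apply, add_smul, left_eq_add] at h2
  exact (smul_ne_zero ht hc.1) h2

lemma exists_hw (M : Type) [AddCommGroup M] [Module ℂ M] [LieRingModule g M] [LieModule ℂ g M]
    [FiniteDimensional ℂ M] [Nontrivial M] : ∃ (l : Dual ℂ H) (v : M), v ≠ 0 ∧ D.HW l v := by
  obtain ⟨μ, v0, hv0, hμ⟩ := D.wtex M
  let S : Set (ι →₀ ℕ) := {b | ∃ v ∈ D.wtS M (μ - D.psi b), v ≠ 0}
  have hfin : S.Finite := by
    refine Set.Finite.of_finite_image (f := fun b => μ - D.psi b)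
      ((D.wts_finite (M := M)).subset ?_) ?_
    · rintro _ ⟨b, hb, rfl⟩; exact hb
    · intro b _ b' _ hbb
      exact D.psi_inj (sub_right_injective hbb)
  obtain ⟨b, hb, hmax⟩ := Set.exists_max_image S (fun b => ∑ i, b i) hfin
    ⟨0, v0, by intro h; simpa using hμ h, hv0⟩
  obtain ⟨v, hv, hv0⟩ := hb
  refine ⟨_, v, hv0, hv, fun α hα => ?_⟩
  by_contra hne
  obtain ⟨n, hn, hn'⟩ := D.Pcomb α hα
  have h1 := D.shift_x hα hv
  have h2 : b + n ∈ S := by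
    refine ⟨_, ?_, hne⟩
    convert h1 using 2
    rw [map_add, D.psi_apply n, ← hn']; abel
  have h3 := hmax _ h2
  simp only [Finsupp.add_apply, Finset.sum_add_distrib] at h3
  apply hn
  ext i
  have : ∑ i, n i = 0 := by omega
  simpa using (Finset.sum_eq_zero_iff.1 this) i (Finset.mem_univ i)

end RD
end RDsec
end UFT

set_option linter.unusedSectionVars false
namespace UFT
section ExpSec

open Module

/-- conjugation by an exponential -/
lemma exp_conj {A : Type} [Ring A] [Algebra ℂ A] [Module ℚ A] {a z w v : A} (ha : IsNilpotent a)
    (h1 : a * z - z * a = w) (h2 : a * w - w * a = v) (h3 : a * v - v * a = 0) :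
    IsNilpotent.exp a * z = (z + w + (2⁻¹ : ℚ) • v) * IsNilpotent.exp a := by
  let la : Module.End ℂ A := LinearMap.mulLeft ℂ a
  let ra : Module.End ℂ A := LinearMap.mulRight ℂ (-a)
  obtain ⟨k, hk⟩ := ha
  have hk' : (-a) ^ k = 0 := by rw [neg_pow, hk, mul_zero]
  have hla : la ^ k = 0 := by
    simp only [la, LinearMap.pow_mulLeft, hk]; ext; simp
  have hra : ra ^ k = 0 := by
    simp only [ra, LinearMap.pow_mulRight, hk']; ext; simp
  have hcomm : Commute la ra := by
    ext y; simp [la, ra, mul_assoc]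
  have hD : ∀ y, (la + ra) y = a * y - y * a := by
    intro y; simp [la, ra, sub_eq_add_neg]
  have e1 := IsNilpotent.exp_add_of_commute hcomm ⟨k, hla⟩ ⟨k, hra⟩
  have e2 : IsNilpotent.exp la = LinearMap.mulLeft ℂ (IsNilpotent.exp a) := by
    ext y
    rw [IsNilpotent.exp_eq_sum hla, IsNilpotent.exp_eq_sum hk, LinearMap.sum_apply]
    simp only [LinearMap.smul_apply, LinearMap.mulLeft_apply, Finset.sum_mul, la, LinearMap.pow_mulLeft,
      smul_mul_assoc]
  have e3 : IsNilpotent.exp ra = LinearMap.mulRight ℂ (IsNilpotent.exp (-a)) := by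
    ext y
    rw [IsNilpotent.exp_eq_sum hra, IsNilpotent.exp_eq_sum hk', LinearMap.sum_apply]
    simp only [LinearMap.smul_apply, LinearMap.mulRight_apply, Finset.mul_sum, ra, LinearMap.pow_mulRight,
      mul_smul_comm]
  have e4 : IsNilpotent.exp (la + ra) • z =
      ∑ i ∈ Finset.range 3, (i.factorial : ℚ)⁻¹ • ((la + ra) ^ i) • z :=
    IsNilpotent.exp_smul_eq_sum (by
      simp only [Module.End.smul_def, pow_succ, pow_zero, one_mul, Module.End.mul_apply]
      rw [hD z, h1, hD w, h2, hD v, h3]) (hcomm.isNilpotent_add ⟨k, hla⟩ ⟨k, hra⟩)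
  rw [e1, e2, e3] at e4
  simp only [Module.End.smul_def, Module.End.mul_apply, LinearMap.mulLeft_apply,
    LinearMap.mulRight_apply, Finset.sum_range_succ, Finset.sum_range_zero, pow_succ, pow_zero,
    one_mul, Module.End.one_apply] at e4
  rw [hD z, h1, hD, h2] at e4
  have e5 : IsNilpotent.exp (-a) * IsNilpotent.exp a = 1 := IsNilpotent.exp_neg_mul_exp_self ⟨k, hk⟩
  calc IsNilpotent.exp a * z = (IsNilpotent.exp a * (z * IsNilpotent.exp (-a))) * IsNilpotent.exp a := by
        rw [mul_assoc, mul_assoc, e5, mul_one]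
    _ = _ := by rw [e4]; simp [Nat.factorial]

end ExpSec
section RDsec2

open Module
open scoped TensorProduct

variable {g : Type} [LieRing g] [LieAlgebra ℂ g] {H : Type} [AddCommGroup H] [Module ℂ H]
  {ι : Type} [Fintype ι] [DecidableEq ι]

namespace RD

variable (D : RD g H ι)
variable {M : Type} [AddCommGroup M] [Module ℂ M] [LieRingModule g M] [LieModule ℂ g M]

lemma toEnd_lie (x y : g) : LieModule.toEnd ℂ g M ⁅x, y⁆ =
    LieModule.toEnd ℂ g M x * LieModule.toEnd ℂ g M y -
      LieModule.toEnd ℂ g M y * LieModule.toEnd ℂ g M x := by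
  ext m
  simp [lie_lie]

lemma irr_top (hirr : LieModule.IsIrreducible ℂ g M) (S : LieSubmodule ℂ g M) (v : M) (hv : v ≠ 0)
    (h : v ∈ S) : S = ⊤ := by
  rcases eq_bot_or_eq_top S with h1 | h1
  · rw [h1] at h
    exact absurd (by simpa using h) hv
  · exact h1

lemma P_ne_zero {α : Dual ℂ H} (hα : α ∈ D.P) : α ≠ 0 := by
  obtain ⟨n, hn, hn'⟩ := D.Pcomb α hα
  rintro rfl
  apply hn
  apply D.psi_inj
  rw [D.psi_apply, ← hn']; simp

lemma nilp [FiniteDimensional ℂ M] {κ : Type} [Fintype κ] {b : Basis κ ℂ M} {w : κ → Dual ℂ H}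
    (hw : D.WB κ b w) {α : Dual ℂ H} (hα : α ≠ 0) (z : g)
    (hz : ∀ μ, ∀ v ∈ D.wtS M μ, ⁅z, v⁆ ∈ D.wtS M (μ + α)) : IsNilpotent (LieModule.toEnd ℂ g M z) := by
  rw [Module.End.isNilpotent_iff_of_finite]
  set f := LieModule.toEnd ℂ g M z
  have hb : ∀ i, ∃ n : ℕ, (f ^ n) (b i) = 0 := by
    intro i
    have hs : ∀ n : ℕ, (f ^ n) (b i) ∈ D.wtS M (w i + (n : ℂ) • α) := by
      intro n
      induction n with
      | zero => simpa using hw.wt i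
      | succ n ih =>
        rw [pow_succ', Module.End.mul_apply]
        have := hz _ _ ih
        have e : w i + ((n + 1 : ℕ) : ℂ) • α = w i + (n : ℂ) • α + α := by
          push_cast
          rw [add_smul, one_smul, add_assoc]
        rw [e]
        exact this
    by_contra hcon
    push Not at hcon
    have hinj : Function.Injective (fun n : ℕ => w i + (n : ℂ) • α) := by
      intro n m hnm
      have : (n : ℂ) • α = (m : ℂ) • α := add_left_cancel hnm
      exact_mod_cast smul_left_injective ℂ hα this
    exact Set.infinite_range_of_injective hinj
      ((D.wts_finite (M := M)).subset (by rintro _ ⟨n, rfl⟩; exact ⟨_, hs n, hcon n⟩))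
  intro m
  have hm : m ∈ Submodule.span ℂ (Set.range b) := by rw [b.span_eq]; trivial
  induction hm using Submodule.span_induction with
  | mem x hx => obtain ⟨i, rfl⟩ := hx; exact hb i
  | zero => exact ⟨0, by simp⟩
  | add x y _ _ hx hy =>
    obtain ⟨n, hn⟩ := hx
    obtain ⟨m, hm⟩ := hy
    refine ⟨n + m, ?_⟩
    rw [map_add]
    nth_rewrite 1 [add_comm n m]
    rw [pow_add, pow_add, Module.End.mul_apply, Module.End.mul_apply, hn, hm]
    simp
  | smul c x _ hx =>
    obtain ⟨n, hn⟩ := hx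
    exact ⟨n, by rw [map_smul, hn, smul_zero]⟩

lemma inv_of [FiniteDimensional ℂ M] {f : GAlg H} (h : D.HasChar M f) (i : ι) : D.sig i f = f := by
  have h0 := h
  obtain ⟨κ, _, b, w, hw, rfl⟩ := h
  let _ : Module ℚ (Module.End ℂ M) := Module.compHom _ (algebraMap ℚ ℂ)
  have hP := D.aP i
  have hsl := D.sl2 _ hP
  have hhc : D.c (D.a i) • D.em (D.t (D.a i)) = D.em (D.hc i) := by rw [D.hc_eq, map_smul]
  rw [hhc] at hsl
  set e := LieModule.toEnd ℂ g M (D.x (D.a i)) with he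
  set f := LieModule.toEnd ℂ g M (D.c (D.a i) • D.y (D.a i)) with hf
  set t := LieModule.toEnd ℂ g M (D.em (D.hc i)) with ht
  have hef : e * f - f * e = t := by
    rw [he, hf, ht, ← hsl.lie_e_f, toEnd_lie]
  have hte : t * e - e * t = 2 * e := by
    have := congrArg (LieModule.toEnd ℂ g M) hsl.lie_h_e_nsmul
    rw [toEnd_lie, map_nsmul] at this
    rw [this, two_mul, two_smul]
  have htf : t * f - f * t = - (2 * f) := by
    have := congrArg (LieModule.toEnd ℂ g M) hsl.lie_h_f_nsmul
    rw [toEnd_lie, map_neg, map_nsmul] at this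
    rw [this, two_mul, two_smul]
  have ene : IsNilpotent e := D.nilp hw (D.P_ne_zero hP) _ (fun μ v hv => D.shift_x hP hv)
  have enf : IsNilpotent (-f) := by
    have : IsNilpotent f := D.nilp hw (neg_ne_zero.2 (D.P_ne_zero hP)) _ (fun μ v hv => by
      rw [smul_lie, ← sub_eq_add_neg]
      exact Submodule.smul_mem _ _ (D.shift_y hP hv))
    exact this.neg
  set E := IsNilpotent.exp e with hE
  set F := IsNilpotent.exp (-f) with hF
  have c1 : E * t = (t - 2 * e) * E := by
    have := exp_conj (z := t) (w := -(2 * e)) (v := 0) ene (by rw [← hte]; abel)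
      (by noncomm_ring) (by simp)
    rw [this]; simp [sub_eq_add_neg]; rfl
  have c2 : E * e = e * E := by
    have := exp_conj (z := e) (w := 0) (v := 0) ene (by simp) (by simp) (by simp)
    rw [this]; simp; rfl
  have c3 : F * t = (t - 2 * f) * F := by
    have := exp_conj (z := t) (w := -(2 * f)) (v := 0) enf (by rw [← htf]; noncomm_ring)
      (by noncomm_ring) (by simp)
    rw [this]; simp [sub_eq_add_neg]; rfl
  have c4 : F * e = (e + t - f) * F := by
    have := exp_conj (z := e) (w := t) (v := -(2 * f)) enf (by rw [← hef]; noncomm_ring)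
      (by rw [← htf]; noncomm_ring) (by noncomm_ring)
    rw [this]
    have h2 : (2⁻¹ : ℚ) • (-(2 * f)) = - f := by
      rw [two_mul, ← two_smul ℚ f, smul_neg, smul_smul]; norm_num
    rw [h2, sub_eq_add_neg]
  have c5 : ∀ z : End ℂ M, e * z = z * e → E * z = z * E := by
    intro z hz
    have := exp_conj (z := z) (w := 0) (v := 0) ene (by rw [hz]; simp) (by simp) (by simp)
    rw [this]; simp; rfl
  have c6 : ∀ z : End ℂ M, f * z = z * f → F * z = z * F := by
    intro z hz
    have := exp_conj (z := z) (w := 0) (v := 0) enf (by rw [neg_mul, hz]; simp) (by simp) (by simp)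
    rw [this]; simp; rfl
  set θ := E * F * E with hθ
  have k1 : θ * t = - (t * θ) := by
    calc θ * t = E * F * (E * t) := by rw [hθ]; noncomm_ring
      _ = E * (F * t - 2 * (F * e)) * E := by rw [c1]; noncomm_ring
      _ = (- (E * t) - 2 * (E * e)) * F * E := by rw [c3, c4]; noncomm_ring
      _ = - (t * θ) := by rw [c1, c2, hθ]; noncomm_ring
  have k2 : ∀ z : End ℂ M, e * z = z * e → f * z = z * f → θ * z = z * θ := by
    intro z h1 h2
    calc θ * z = E * F * (E * z) := by rw [hθ]; noncomm_ring
      _ = E * (F * z) * E := by rw [c5 z h1]; noncomm_ring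
      _ = (E * z) * F * E := by rw [c6 z h2]; noncomm_ring
      _ = z * θ := by rw [c5 z h1, hθ]; noncomm_ring
  have k3 : ∀ s : H, θ * LieModule.toEnd ℂ g M (D.em s) =
      LieModule.toEnd ℂ g M (D.em (s - D.a i s • D.hc i)) * θ := by
    intro s
    set s' : H := s - (D.a i s / 2) • D.hc i with hs'
    have has : D.a i s' = 0 := by
      rw [hs', map_sub, map_smul, D.a_hc_self, smul_eq_mul]; ring
    have k4 := k2 (LieModule.toEnd ℂ g M (D.em s')) (by
        have := congrArg (LieModule.toEnd ℂ g M) (D.hx _ hP s')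
        rw [toEnd_lie, has, zero_smul, map_zero, sub_eq_zero] at this
        exact this.symm) (by
        have := congrArg (LieModule.toEnd ℂ g M) (D.hy _ hP s')
        rw [toEnd_lie, has, neg_zero, zero_smul, map_zero, sub_eq_zero] at this
        rw [hf, map_smul, smul_mul_assoc, mul_smul_comm, this])
    have es : s = s' + (D.a i s / 2) • D.hc i := by rw [hs']; abel
    have es2 : s - D.a i s • D.hc i = s' - (D.a i s / 2) • D.hc i := by
      rw [hs', sub_sub, ← add_smul]; congr 2; ring
    clear_value s'
    rw [es2]
    conv_lhs => rw [es]
    simp only [map_add, map_sub, map_smul, mul_add, sub_mul, ← ht, mul_smul_comm, smul_mul_assoc]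
    rw [k4, k1, smul_neg, sub_eq_add_neg]
  have hu : IsUnit θ := (((IsNilpotent.isUnit_exp ene).mul (IsNilpotent.isUnit_exp enf)).mul
    (IsNilpotent.isUnit_exp ene))
  let eq : M ≃ₗ[ℂ] M := LinearEquiv.ofBijective θ ((Module.End.isUnit_iff θ).1 hu)
  have heq : ∀ v, eq v = θ v := fun v => rfl
  have hchar : D.HasChar M (∑ j, ex (D.s i (w j))) := by
    refine ⟨κ, inferInstance, b.map eq, fun j => D.s i (w j), ⟨fun j s => ?_⟩, rfl⟩
    rw [Basis.map_apply, heq]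
    have := LinearMap.congr_fun (k3 (s - D.a i s • D.hc i)) (b j)
    have es : (s - D.a i s • D.hc i) - D.a i (s - D.a i s • D.hc i) • D.hc i = s := by
      rw [map_sub, map_smul, D.a_hc_self, smul_eq_mul, sub_sub, ← add_smul]
      have : D.a i s + (D.a i s - D.a i s * 2) = 0 := by ring
      rw [this]; simp
    rw [es] at this
    simp only [Module.End.mul_apply, LieModule.toEnd_apply_apply] at this
    rw [← this, hw.wt j, map_smul, D.s_apply]
    simp [mul_comm]
  have := HasChar.unique D hchar h0
  rw [map_sum]
  simp only [D.sig_ex]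
  exact this

/-- The map `g ⊗ g → End M`. -/
noncomputable def Phi (M : Type) [AddCommGroup M] [Module ℂ M] [LieRingModule g M]
    [LieModule ℂ g M] : g ⊗[ℂ] g →ₗ[ℂ] End ℂ M :=
  TensorProduct.lift ((LinearMap.mul ℂ (End ℂ M)).compl₁₂ (LieModule.toEnd ℂ g M : g →ₗ[ℂ] End ℂ M)
    (LieModule.toEnd ℂ g M : g →ₗ[ℂ] End ℂ M))

lemma Phi_tmul (x y : g) : Phi M (x ⊗ₜ y) = LieModule.toEnd ℂ g M x * LieModule.toEnd ℂ g M y := rfl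

lemma Phi_lie (z : g) (T : g ⊗[ℂ] g) : Phi M ⁅z, T⁆ =
    LieModule.toEnd ℂ g M z * Phi M T - Phi M T * LieModule.toEnd ℂ g M z := by
  induction T using TensorProduct.induction_on with
  | zero => simp
  | tmul x y =>
    rw [TensorProduct.LieModule.lie_tmul_right, map_add, Phi_tmul, Phi_tmul, Phi_tmul,
      toEnd_lie, toEnd_lie]
    noncomm_ring
  | add a b ha hb => rw [lie_add, map_add, ha, hb, map_add]; noncomm_ring

/-- The Casimir operator. -/
noncomputable def Cas (M : Type) [AddCommGroup M] [Module ℂ M] [LieRingModule g M]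
    [LieModule ℂ g M] : End ℂ M :=
  Phi M (∑ j, D.em (D.u j) ⊗ₜ[ℂ] D.em (D.u' j) + ∑ α ∈ D.P, (D.x α ⊗ₜ[ℂ] D.y α + D.y α ⊗ₜ[ℂ] D.x α))

lemma Cas_scalar [FiniteDimensional ℂ M] (hirr : LieModule.IsIrreducible ℂ g M) :
    ∃ c : ℂ, ∀ v : M, D.Cas M v = c • v := by
  have : Nontrivial M := LieModule.nontrivial_of_isIrreducible ℂ g M
  obtain ⟨c, hc⟩ := Module.End.exists_eigenvalue (D.Cas M)
  obtain ⟨v, hv⟩ := hc.exists_hasEigenvector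
  refine ⟨c, ?_⟩
  let S : LieSubmodule ℂ g M :=
    { Module.End.eigenspace (D.Cas M) c with
      lie_mem := by
        intro z m hm
        have hm' : D.Cas M m = c • m := Module.End.mem_eigenspace_iff.1 hm
        apply Module.End.mem_eigenspace_iff.2
        have := Phi_lie (M := M) z _ |>.symm.trans (congrArg (Phi M) (D.cas z))
        rw [map_zero, sub_eq_zero] at this
        have := LinearMap.congr_fun this m
        change ⁅z, D.Cas M m⁆ = D.Cas M ⁅z, m⁆ at this
        rw [← this, hm', lie_smul] }
  have hS : S = ⊤ := irr_top hirr S v hv.2 hv.1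
  intro m
  have : m ∈ S := by rw [hS]; trivial
  exact Module.End.mem_eigenspace_iff.1 this

/-- weighted trace -/
noncomputable def Tr {κ : Type} [Fintype κ] (b : Basis κ ℂ M) (w : κ → Dual ℂ H) :
    End ℂ M →ₗ[ℂ] GAlg H where
  toFun X := ∑ i, (b.repr (X (b i)) i) • ex (w i)
  map_add' X Y := by simp [add_smul, Finset.sum_add_distrib]
  map_smul' c X := by simp [smul_smul, Finset.smul_sum]

lemma Tr_apply {κ : Type} [Fintype κ] (b : Basis κ ℂ M) (w : κ → Dual ℂ H) (X : End ℂ M) :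
    Tr b w X = ∑ i, (b.repr (X (b i)) i) • ex (w i) := rfl

lemma repr_mul {κ : Type} [Fintype κ] (b : Basis κ ℂ M) (X Y : End ℂ M) (i j : κ) :
    b.repr (X (Y (b i))) j = ∑ k, b.repr (X (b k)) j * b.repr (Y (b i)) k := by
  conv_lhs => rw [← b.sum_repr (Y (b i)), map_sum, map_sum, Finsupp.finsetSum_apply]
  refine Finset.sum_congr rfl fun k _ => ?_
  rw [map_smul, map_smul, Finsupp.smul_apply, smul_eq_mul, mul_comm]

lemma Tr_diag {κ : Type} [Fintype κ] (b : Basis κ ℂ M) (w : κ → Dual ℂ H) (X : End ℂ M) (a : κ → ℂ)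
    (h : ∀ i, X (b i) = a i • b i) : Tr b w X = ∑ i, a i • ex (w i) := by
  rw [Tr_apply]
  refine Finset.sum_congr rfl fun i _ => ?_
  rw [h i, map_smul, Finsupp.smul_apply, b.repr_self]; simp

lemma Tr_comm {κ : Type} [Fintype κ] {b : Basis κ ℂ M} {w : κ → Dual ℂ H} (hw : D.WB κ b w)
    {α : Dual ℂ H} (X Y : End ℂ M) (hY : ∀ i, Y (b i) ∈ D.wtS M (w i - α)) :
    Tr b w (Y * X) = ex (-α) * Tr b w (X * Y) := by
  rw [Tr_apply, Tr_apply]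
  simp only [Module.End.mul_apply, repr_mul, Finset.sum_smul, Finset.mul_sum]
  rw [Finset.sum_comm]
  refine Finset.sum_congr rfl fun i _ => Finset.sum_congr rfl fun k _ => ?_
  by_cases hk : w k = w i - α
  · rw [hk, mul_smul_comm, ← ex_add, mul_comm, neg_add_eq_sub]
  · rw [hw.coord D (hY i) k hk]; simp

theorem isChar [FiniteDimensional ℂ M] (hirr : LieModule.IsIrreducible ℂ g M) {l : Dual ℂ H} {v : M}
    (hv : v ≠ 0) (h : D.HW l v) : ∃ k ch, D.IsChar l k ch ∧ D.HasChar M ch := by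
  classical
  have hcyc : Cyc g v := ⟨hv, fun S hS => irr_top hirr S v hv hS⟩
  obtain ⟨κ, _, b, d, i0, hw, hb0, hd0, hd⟩ := D.wd_basis h hcyc
  set w := fun i => l + D.psi (d i) with hwdef
  have hch : D.HasChar M (∑ i, ex (w i)) := ⟨κ, inferInstance, b, w, hw, rfl⟩
  have hInt : ∀ i, ∃ n : ℕ, l (D.hc i) = n := by
    intro i
    have hP := D.aP i
    have hsl := D.sl2 _ hP
    have hp : IsSl2Triple.HasPrimitiveVectorWith hsl v (l (D.hc i)) := by
      refine ⟨hv, ?_, h.kill _ hP⟩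
      rw [← h.wt, D.hc_eq, map_smul]
    exact hp.exists_nat
  choose k hk using hInt
  refine ⟨Finsupp.equivFunOnFinite.symm k, ∑ i, ex (w i), ⟨?_, fun i => D.inv_of hch i, ?_, ?_⟩, hch⟩
  · apply CD.Lead.of_supp
    · rw [ch_coeff]
      have : (Finset.univ.filter fun i => w i = l) = {i0} := by
        ext i
        simp only [Finset.mem_filter, Finset.mem_univ, true_and, Finset.mem_singleton, hwdef]
        constructor
        · intro hi
          apply hd
          apply D.psi_inj
          rw [map_zero]
          simpa using hi
        · rintro rfl
          rw [hd0]; simp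
      rw [this]; simp
    · intro μ hμ
      rw [ch_coeff] at hμ
      have : (Finset.univ.filter fun i => w i = μ).card ≠ 0 := by exact_mod_cast hμ
      obtain ⟨i, hi⟩ := Finset.card_ne_zero.1 this
      exact ⟨d i, (Finset.mem_filter.1 hi).2.symm⟩
  · intro i
    simpa using hk i
  · obtain ⟨c, hc⟩ := D.Cas_scalar hirr
    let rx := fun z => LieModule.toEnd ℂ g M z
    refine ⟨c, fun α => Tr b w (rx (D.x α) * rx (D.y α)), ?_, ?_⟩
    · have h1 : Tr b w (D.Cas M) = c • ∑ i, ex (w i) := by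
        rw [Tr_diag b w _ (fun _ => c) (fun i => hc _), Finset.smul_sum]
      rw [← h1, Cas, map_add, map_add, map_sum, map_sum, map_sum, map_sum]
      congr 1
      · have : ∀ j, Tr b w (Phi M (D.em (D.u j) ⊗ₜ[ℂ] D.em (D.u' j))) =
            ∑ i, (w i (D.u j) * w i (D.u' j)) • ex (w i) := by
          intro j
          apply Tr_diag
          intro i
          rw [Phi_tmul, Module.End.mul_apply, LieModule.toEnd_apply_apply,
            LieModule.toEnd_apply_apply, hw.wt i, lie_smul, hw.wt i, smul_smul, mul_comm]
        simp only [this]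
        rw [Finset.sum_comm, map_sum]
        refine Finset.sum_congr rfl fun i _ => ?_
        rw [D.Lap_ex, D.hB, Finset.sum_smul]
      · refine Finset.sum_congr rfl fun α hα => ?_
        rw [map_add, map_add, Phi_tmul, Phi_tmul, add_mul, one_mul]
        congr 1
        exact D.Tr_comm hw _ _ (fun i => D.shift_y hα (hw.wt i))
    · intro α hα
      rw [sub_mul, one_mul]
      rw [← D.Tr_comm hw (α := α) (rx (D.x α)) (rx (D.y α)) (fun i => D.shift_y hα (hw.wt i)), ← map_sub]
      have : rx (D.x α) * rx (D.y α) - rx (D.y α) * rx (D.x α) = rx (D.em (D.t α)) := by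
        simp only [rx]
        rw [← D.hxy α hα, toEnd_lie]
      rw [this, Tr_diag b w _ (fun i => w i (D.t α)) (fun i => hw.wt i _), map_sum]
      exact Finset.sum_congr rfl fun i _ => (der_ex _ _).symm

theorem trivial_of_zero [FiniteDimensional ℂ M] (hirr : LieModule.IsIrreducible ℂ g M) {v : M}
    (hv : v ≠ 0) (h : D.HW 0 v) : LieModule.IsTrivial g M := by
  have hkill : ∀ z : g, ⁅z, v⁆ = 0 := by
    intro z
    have htop := D.span (LinearMap.ker ((LieModule.toEnd ℂ g M : g →ₗ[ℂ] End ℂ M).flip v)) ?_ ?_ ?_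
    · have : z ∈ (⊤ : Submodule ℂ g) := trivial
      rw [← htop] at this
      exact this
    · intro t
      change ⁅D.em t, v⁆ = 0
      rw [h.wt t]; simp
    · intro α hα
      exact h.kill α hα
    · intro α hα
      change ⁅D.y α, v⁆ = 0
      have hsl := D.sl2 _ hα
      have hp : IsSl2Triple.HasPrimitiveVectorWith hsl v (0 : ℂ) := by
        refine ⟨hv, ?_, h.kill _ hα⟩
        rw [smul_lie, h.wt]; simp
      have := hp.pow_toEnd_f_eq_zero_of_eq_nat (n := 0) (by simp)
      simp only [zero_add, pow_one, LieModule.toEnd_apply_apply, smul_lie] at this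
      refine (smul_eq_zero.1 this).resolve_left ?_
      intro hc
      exact hsl.h_ne_zero (by rw [hc, zero_smul])
  have : LieModule.maxTrivSubmodule ℂ g M = ⊤ := irr_top hirr _ v hv hkill
  refine ⟨fun z m => ?_⟩
  have hm : m ∈ LieModule.maxTrivSubmodule ℂ g M := by rw [this]; trivial
  exact hm z

end RD
end RDsec2
end UFT

set_option linter.unusedSectionVars false
namespace UFT
section RDsec3

open Module
open scoped TensorProduct

variable {g : Type} [LieRing g] [LieAlgebra ℂ g] {H : Type} [AddCommGroup H] [Module ℂ H]
  {ι : Type} [Fintype ι] [DecidableEq ι]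

/-- The direct sum of two Lie modules (ring module part). -/
@[reducible] def prodLRM (g M N : Type) [LieRing g] [AddCommGroup M] [LieRingModule g M]
    [AddCommGroup N] [LieRingModule g N] : LieRingModule g (M × N) where
  bracket z p := (⁅z, p.1⁆, ⁅z, p.2⁆)
  add_lie x y p := by ext <;> simp
  lie_add x p q := by ext <;> simp
  leibniz_lie x y p := by ext <;> simp

namespace RD

variable (D : RD g H ι)
variable {M : Type} [AddCommGroup M] [Module ℂ M] [LieRingModule g M] [LieModule ℂ g M]
variable {N : Type} [AddCommGroup N] [Module ℂ N] [LieRingModule g N] [LieModule ℂ g N]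

theorem iso_of_hw [FiniteDimensional ℂ M] [FiniteDimensional ℂ N]
    (hM : LieModule.IsIrreducible ℂ g M) (hN : LieModule.IsIrreducible ℂ g N)
    {l : Dual ℂ H} {v : M} {v' : N} (hv : v ≠ 0) (hv' : v' ≠ 0) (h : D.HW l v) (h' : D.HW l v') :
    Nonempty (M ≃ₗ⁅ℂ,g⁆ N) := by
  letI : LieRingModule g (M × N) := prodLRM g M N
  letI : LieModule ℂ g (M × N) :=
    { smul_lie := fun c x p => Prod.ext (smul_lie c x p.1) (smul_lie c x p.2)
      lie_smul := fun c x p => Prod.ext (lie_smul c x p.1) (lie_smul c x p.2) }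
  have hbr : ∀ (z : g) (p : M × N), ⁅z, p⁆ = (⁅z, p.1⁆, ⁅z, p.2⁆) := fun _ _ => rfl
  let S : LieSubmodule ℂ g (M × N) := LieSubmodule.lieSpan ℂ g {(v, v')}
  have hpS : (v, v') ∈ S := LieSubmodule.subset_lieSpan rfl
  let p : S := ⟨(v, v'), hpS⟩
  have hp0 : p ≠ 0 := by
    intro hp
    exact hv (congrArg (fun q : S => q.1.1) hp)
  have hHW : D.HW l p := by
    constructor
    · intro t
      apply Subtype.ext
      exact Prod.ext (h.wt t) (h'.wt t)
    · intro α hα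
      apply Subtype.ext
      exact Prod.ext (h.kill α hα) (h'.kill α hα)
  have hcyc : Cyc g p := by
    refine ⟨hp0, fun T hT => ?_⟩
    have h1 : S ≤ T.map S.incl := by
      apply LieSubmodule.lieSpan_le.2
      rintro _ rfl
      exact LieSubmodule.mem_map _ |>.2 ⟨p, hT, rfl⟩
    rw [eq_top_iff]
    intro q _
    obtain ⟨r, hr, hrq⟩ := (LieSubmodule.mem_map _).1 (h1 q.2)
    have : r = q := Subtype.ext hrq
    rwa [← this]
  obtain ⟨κ, _, b, d, i0, hw, hb0, hd0, hd⟩ := D.wd_basis hHW hcyc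
  have hmult : ∀ q : S, q ∈ D.wtS S l → ∃ c : ℂ, q = c • p := by
    intro q hq
    refine ⟨b.repr q i0, ?_⟩
    conv_lhs => rw [← b.sum_repr q]
    rw [Finset.sum_eq_single i0]
    · rw [hb0]
    · intro i _ hi
      rw [hw.coord D hq i, zero_smul]
      intro hl
      apply hi
      apply hd
      apply D.psi_inj
      rw [map_zero]
      simpa using hl
    · simp
  let f1 : S →ₗ⁅ℂ,g⁆ M := { toLinearMap := (LinearMap.fst ℂ M N).comp S.incl.toLinearMap, map_lie' := fun {_ _} => rfl }
  let f2 : S →ₗ⁅ℂ,g⁆ N := { toLinearMap := (LinearMap.snd ℂ M N).comp S.incl.toLinearMap, map_lie' := fun {_ _} => rfl }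
  have hf1 : ∀ q : S, f1 q = q.1.1 := fun _ => rfl
  have hf2 : ∀ q : S, f2 q = q.1.2 := fun _ => rfl
  have s1 : Function.Surjective f1 := by
    rw [← LieModuleHom.range_eq_top]
    exact irr_top hM _ v hv ((LieModuleHom.mem_range _ _).2 ⟨p, rfl⟩)
  have s2 : Function.Surjective f2 := by
    rw [← LieModuleHom.range_eq_top]
    exact irr_top hN _ v' hv' ((LieModuleHom.mem_range _ _).2 ⟨p, rfl⟩)
  have i1 : Function.Injective f1 := by
    rw [injective_iff_map_eq_zero]
    intro q hq
    by_contra hne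
    have hT := irr_top hN (f1.ker.map f2) (f2 q) (by
      intro hq2; exact hne (Subtype.ext (Prod.ext hq hq2)))
      ((LieSubmodule.mem_map _).2 ⟨q, (LieModuleHom.mem_ker).2 hq, rfl⟩)
    have : v' ∈ f1.ker.map f2 := by rw [hT]; trivial
    obtain ⟨r, hr, hr2⟩ := (LieSubmodule.mem_map _).1 this
    have hr1 : r.1.1 = 0 := (LieModuleHom.mem_ker).1 hr
    obtain ⟨c, hc⟩ := hmult r (by
      intro t
      apply Subtype.ext
      refine Prod.ext ?_ ?_
      · change ⁅D.em t, r.1.1⁆ = l t • r.1.1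
        rw [hr1]; simp
      · change ⁅D.em t, r.1.2⁆ = l t • r.1.2
        rw [← hf2, hr2]; exact h'.wt t)
    have hc1 : c • v = 0 := by
      rw [← hr1, hc]; rfl
    have hc0 : c = 0 := (smul_eq_zero.1 hc1).resolve_right hv
    rw [hc0, zero_smul] at hc
    rw [hc, map_zero] at hr2
    exact hv' hr2.symm
  have i2 : Function.Injective f2 := by
    rw [injective_iff_map_eq_zero]
    intro q hq
    by_contra hne
    have hT := irr_top hM (f2.ker.map f1) (f1 q) (by
      intro hq2; exact hne (Subtype.ext (Prod.ext hq2 hq)))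
      ((LieSubmodule.mem_map _).2 ⟨q, (LieModuleHom.mem_ker).2 hq, rfl⟩)
    have : v ∈ f2.ker.map f1 := by rw [hT]; trivial
    obtain ⟨r, hr, hr2⟩ := (LieSubmodule.mem_map _).1 this
    have hr1 : r.1.2 = 0 := (LieModuleHom.mem_ker).1 hr
    obtain ⟨c, hc⟩ := hmult r (by
      intro t
      apply Subtype.ext
      refine Prod.ext ?_ ?_
      · change ⁅D.em t, r.1.1⁆ = l t • r.1.1
        rw [← hf1, hr2]; exact h.wt t
      · change ⁅D.em t, r.1.2⁆ = l t • r.1.2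
        rw [hr1]; simp)
    have hc1 : c • v' = 0 := by
      rw [← hr1, hc]; rfl
    have hc0 : c = 0 := (smul_eq_zero.1 hc1).resolve_right hv'
    rw [hc0, zero_smul] at hc
    rw [hc, map_zero] at hr2
    exact hv hr2.symm
  let e1 : S ≃ₗ⁅ℂ,g⁆ M := { LinearEquiv.ofBijective f1.toLinearMap ⟨i1, s1⟩ with map_lie' := fun {_ _} => rfl }
  let e2 : S ≃ₗ⁅ℂ,g⁆ N := { LinearEquiv.ofBijective f2.toLinearMap ⟨i2, s2⟩ with map_lie' := fun {_ _} => rfl }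
  exact ⟨e1.symm.trans e2⟩

end RD
end RDsec3
end UFT

set_option linter.unusedSectionVars false
namespace UFT

section RootSys
open Module
variable {ι M N : Type} [Finite ι] [AddCommGroup M] [AddCommGroup N] [Module ℂ M] [Module ℂ N]
  {P : RootPairing ι ℂ M N} (b : P.Base)

lemma pos_or (i : ι) : b.IsPos i ∨ ∃ j, b.IsPos j ∧ P.root i = - P.root j := by
  let := P.indexNeg
  rcases RootPairing.Base.IsPos.or_neg b i with h | h
  · exact Or.inl h
  · refine Or.inr ⟨-i, h, ?_⟩
    simp

lemma pos_ne_neg {i j : ι} (hi : b.IsPos i) (hj : b.IsPos j) : P.root i ≠ - P.root j := by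
  let := P.indexNeg
  intro h
  have : i = -j := P.root.injective (by simpa using h)
  subst this
  exact (RootPairing.Base.IsPos.neg_iff_not b j).1 hi hj

lemma pos_comb {i : ι} (hi : b.IsPos i) : ∃ n : b.support →₀ ℕ, n ≠ 0 ∧
    P.root i = ∑ j : b.support, (n j : ℂ) • P.root j := by
  obtain ⟨f, hf, h | h⟩ := b.exists_root_eq_sum_nat_or_neg i
  · have h2 : P.root i = ∑ j : b.support, (f j : ℂ) • P.root j := by
      rw [h, ← Finset.sum_coe_sort b.support]
      exact Finset.sum_congr rfl fun j _ => (Nat.cast_smul_eq_nsmul ℂ _ _).symm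
    refine ⟨Finsupp.equivFunOnFinite.symm fun j : b.support => f j, ?_, by simpa using h2⟩
    intro h0
    apply P.ne_zero i
    rw [h2]
    refine Finset.sum_eq_zero fun j _ => ?_
    have : f j = 0 := DFunLike.congr_fun h0 j
    simp [this]
  · exfalso
    have h1 : P.root i = ∑ j ∈ b.support, (-(f j : ℤ)) • P.root j := by
      rw [h, ← Finset.sum_neg_distrib]
      exact Finset.sum_congr rfl fun j _ => by simp
    have h2 := RootPairing.Base.height_eq_sum h1
    have h3 := (RootPairing.Base.isPos_iff b).1 hi
    rw [h2, Finset.sum_neg_distrib] at h3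
    have : (0:ℤ) ≤ ∑ j ∈ b.support, (f j : ℤ) := Finset.sum_nonneg fun j _ => by positivity
    omega

lemma base_conn [P.IsCrystallographic] [P.IsReduced] [P.IsIrreducible] [DecidableEq b.support]
    (A : b.support → b.support → ℤ)
    (hA : ∀ i j : b.support, P.pairing i j = A i j) (v : b.support) :
    Conn (SkewData.dadj A) {v} Finset.univ := by
  intro C _ hC hdis
  by_contra hcon
  have hz : ∀ c ∈ C, ∀ d ∉ C, A c d = 0 := by
    intro c hc d hd
    by_contra hA0
    exact hcon ⟨c, hc, d, by simp [hd], fun h => hd (h ▸ hc), hA0⟩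
  let q : Submodule ℂ M := Submodule.span ℂ (Set.image (fun c : b.support => P.root c) (C : Set b.support))
  have hinv : ∀ i ∈ b.support, q ∈ Module.End.invtSubmodule (P.reflection i : M →ₗ[ℂ] M) := by
    intro i hi
    rw [Module.End.mem_invtSubmodule]
    refine Submodule.span_le.2 ?_
    rintro _ ⟨c, hc, rfl⟩
    show P.reflection i (P.root c) ∈ q
    rw [P.reflection_apply_root]
    refine Submodule.sub_mem _ (Submodule.subset_span ⟨c, hc, rfl⟩) ?_
    by_cases hiC : (⟨i, hi⟩ : b.support) ∈ C
    · exact Submodule.smul_mem _ _ (Submodule.subset_span ⟨⟨i, hi⟩, hiC, rfl⟩)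
    · have := hA c ⟨i, hi⟩
      rw [hz c hc _ hiC] at this
      simp only at this
      rw [this]; simp
  have hq := RootPairing.IsIrreducible.eq_top_of_invtSubmodule_reflection (P := P) q
    ((b.forall_mem_support_invtSubmodule_iff q).1 hinv) (by
      obtain ⟨c, hc⟩ := hC
      intro hbot
      have : P.root c ∈ q := Submodule.subset_span ⟨c, hc, rfl⟩
      rw [hbot, Submodule.mem_bot] at this
      exact P.ne_zero _ this)
  have hv : v ∉ C := fun h => Finset.disjoint_left.1 hdis h (Finset.mem_singleton_self v)
  have hli : LinearIndependent ℂ (fun c : b.support => P.root c) := b.linearIndepOn_root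
  have := hli.notMem_span_image (s := (C : Set b.support)) (x := v) hv
  exact this (by rw [show Submodule.span ℂ _ = (⊤ : Submodule ℂ M) from hq]; trivial)

end RootSys

section Cas
open Module
open scoped TensorProduct

lemma casimir_inv {g : Type} [LieRing g] [LieAlgebra ℂ g] {S : Type} [Fintype S]
    (κ : g → g → ℂ) (inv : ∀ z x y : g, κ x ⁅z, y⁆ = - κ y ⁅z, x⁆) (e f : S → g)
    (h1 : ∀ z, z = ∑ s, κ (f s) z • e s) (h2 : ∀ z, z = ∑ s, κ (e s) z • f s) (z : g) :
    ⁅z, ∑ s, e s ⊗ₜ[ℂ] f s⁆ = 0 := by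
  rw [lie_sum]
  simp only [TensorProduct.LieModule.lie_tmul_right, Finset.sum_add_distrib]
  have e1 : ∑ s, ⁅z, e s⁆ ⊗ₜ[ℂ] f s = ∑ s, ∑ r, κ (f r) ⁅z, e s⁆ • (e r ⊗ₜ[ℂ] f s) := by
    refine Finset.sum_congr rfl fun s _ => ?_
    conv_lhs => rw [h1 ⁅z, e s⁆]
    simp only [TensorProduct.sum_tmul, TensorProduct.smul_tmul']
  have e2 : ∑ s, e s ⊗ₜ[ℂ] ⁅z, f s⁆ = ∑ s, ∑ r, κ (e r) ⁅z, f s⁆ • (e s ⊗ₜ[ℂ] f r) := by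
    refine Finset.sum_congr rfl fun s _ => ?_
    conv_lhs => rw [h2 ⁅z, f s⁆]
    simp only [TensorProduct.tmul_sum, TensorProduct.tmul_smul]
  rw [e1, e2, Finset.sum_comm, ← Finset.sum_add_distrib]
  refine Finset.sum_eq_zero fun s _ => ?_
  rw [← Finset.sum_add_distrib]
  refine Finset.sum_eq_zero fun r _ => ?_
  rw [inv z (f s) (e r)]; simp
end Cas
end UFT

set_option linter.unusedSectionVars false
namespace UFT

section Construct
open Module LieAlgebra LieAlgebra.IsKilling
open scoped TensorProduct

variable {L : Type} [LieRing L] [LieAlgebra ℂ L] [FiniteDimensional ℂ L] [LieAlgebra.IsSimple ℂ L]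
variable (H : LieSubalgebra ℂ L) [H.IsCartanSubalgebra]

lemma root_vecs (α : H.root) : ∃ (x y : L) (c : ℂ), x ∈ rootSpace H α.1 ∧
    y ∈ rootSpace H (-α.1) ∧ killingForm ℂ L x y = 1 ∧
    IsSl2Triple (c • ((cartanEquivDual H).symm ((rootSystem H).root α) : L)) x (c • y) ∧
    coroot α.1 = c • (cartanEquivDual H).symm ((rootSystem H).root α) := by
  have hα : α.1.IsNonZero := LieSubalgebra.isNonZero_coe_root α
  obtain ⟨h, e, f, ht, he, hf⟩ := exists_isSl2Triple_of_weight_isNonZero hα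
  have hef := lie_eq_killingForm_smul_of_mem_rootSpace_of_mem_rootSpace_neg he hf
  have h1 : h = killingForm ℂ L e f • ((cartanEquivDual H).symm ((rootSystem H).root α) : L) := by
    rw [← ht.lie_e_f, hef]; rfl
  have h0 : killingForm ℂ L e f ≠ 0 := by
    intro h0
    rw [h0, zero_smul] at h1
    exact ht.h_ne_zero h1
  refine ⟨e, (killingForm ℂ L e f)⁻¹ • f, killingForm ℂ L e f, he, ?_, ?_, ?_, ?_⟩
  · exact Submodule.smul_mem _ _ hf
  · rw [map_smul, smul_eq_mul, inv_mul_cancel₀ h0]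
  · rw [smul_smul, mul_inv_cancel₀ h0, one_smul, ← h1]; exact ht
  · apply Subtype.ext
    rw [← ht.h_eq_coroot hα he hf, h1]; rfl

lemma tH_symm (μ ν : Dual ℂ H) :
    ν ((cartanEquivDual H).symm μ) = μ ((cartanEquivDual H).symm ν) := by
  obtain ⟨h, rfl⟩ := (cartanEquivDual H).surjective μ
  obtain ⟨h', rfl⟩ := (cartanEquivDual H).surjective ν
  simp only [LinearEquiv.symm_apply_apply, cartanEquivDual_apply_apply]
  exact LieModule.traceForm_comm _ _ _ _ _

lemma tH_kill (μ : Dual ℂ H) (h : H) :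
    killingForm ℂ L ((cartanEquivDual H).symm μ) h = μ h := by
  obtain ⟨h', rfl⟩ := (cartanEquivDual H).surjective μ
  simp only [LinearEquiv.symm_apply_apply, cartanEquivDual_apply_apply]
  rfl

lemma span_all (S : Submodule ℂ L) (h0 : ∀ h : H, (h : L) ∈ S)
    (h1 : ∀ α : H.root, ∃ x ∈ rootSpace H α.1, x ≠ 0 ∧ x ∈ S) : S = ⊤ := by
  have := LieModule.iSup_genWeightSpace_eq_top' ℂ H L
  have h2 := congrArg LieSubmodule.toSubmodule this
  rw [LieSubmodule.iSup_toSubmodule, LieSubmodule.top_toSubmodule] at h2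
  rw [eq_top_iff, ← h2]
  refine iSup_le fun χ => ?_
  by_cases hχ : χ.IsNonZero
  · obtain ⟨x, hx, hx0, hxS⟩ := h1 ⟨χ, by simpa using hχ⟩
    have hr := finrank_rootSpace_eq_one χ hχ
    intro z hz
    obtain ⟨c, hc⟩ := exists_smul_eq_of_finrank_eq_one hr (x := ⟨x, hx⟩)
      (fun h => hx0 (congrArg Subtype.val h)) ⟨z, hz⟩
    have hc' : c • x = z := congrArg Subtype.val hc
    rw [← hc']
    exact S.smul_mem _ hxS
  · have hz : (χ : H → ℂ) = 0 := not_not.1 hχ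
    rw [hz]
    intro z hz
    have : z ∈ rootSpace H (0 : H → ℂ) := hz
    rw [rootSpace_zero_eq] at this
    exact h0 ⟨z, this⟩

end Construct
end UFT

set_option linter.unusedSectionVars false
namespace UFT

section Construct2
open Module LieAlgebra LieAlgebra.IsKilling
open scoped TensorProduct

variable {L : Type} [LieRing L] [LieAlgebra ℂ L] [FiniteDimensional ℂ L] [LieAlgebra.IsSimple ℂ L]
variable (H : LieSubalgebra ℂ L) [H.IsCartanSubalgebra]

/-- the submodule of vectors expanded by a pair of families -/
def expSub {S : Type} [Fintype S] (κ : LinearMap.BilinForm ℂ L) (f e : S → L) : Submodule ℂ L where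
  carrier := {z | z = ∑ s, κ (f s) z • e s}
  add_mem' := by
    intro a b ha hb
    simp only [Set.mem_ofPred_eq, map_add, add_smul, Finset.sum_add_distrib] at *
    rw [← ha, ← hb]
  zero_mem' := by simp
  smul_mem' := by
    intro c a ha
    simp only [Set.mem_ofPred_eq, map_smul, smul_assoc] at *
    rw [← Finset.smul_sum, ← ha]

open Classical in
theorem exists_RD (b : (rootSystem H).Base) : Nonempty (RD L H b.support) := by
  choose X Y Cc hX hY hXY hsl hco using root_vecs H
  let R := rootSystem H
  set t : Dual ℂ H →ₗ[ℂ] H := (cartanEquivDual H).symm.toLinearMap with ht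
  have htsymm : ∀ μ ν : Dual ℂ H, ν (t μ) = μ (t ν) := tH_symm H
  have htk : ∀ (μ : Dual ℂ H) (h : H), killingForm ℂ L (t μ) h = μ h := tH_kill H
  have hkc : ∀ x y : L, killingForm ℂ L x y = killingForm ℂ L y x :=
    LieModule.traceForm_comm ℂ L L
  let P : Finset (Dual ℂ H) := (Finset.univ.filter fun i => b.IsPos i).image R.root
  have hP : ∀ μ, μ ∈ P ↔ ∃ i, b.IsPos i ∧ R.root i = μ := by
    intro μ; simp [P]
  have hPm : ∀ i, b.IsPos i → R.root i ∈ P := fun i hi => (hP _).2 ⟨i, hi, rfl⟩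
  let x : Dual ℂ H → L := Function.extend R.root X 0
  let y : Dual ℂ H → L := Function.extend R.root Y 0
  let c : Dual ℂ H → ℂ := Function.extend R.root Cc 0
  have xe : ∀ i, x (R.root i) = X i := fun i => R.root.injective.extend_apply _ _ _
  have ye : ∀ i, y (R.root i) = Y i := fun i => R.root.injective.extend_apply _ _ _
  have ce : ∀ i, c (R.root i) = Cc i := fun i => R.root.injective.extend_apply _ _ _
  have hcoR : ∀ i, R.coroot i = Cc i • t (R.root i) := hco
  have hrX : ∀ i (h : H), ⁅(h : L), X i⁆ = R.root i h • X i := fun i h =>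
    lie_eq_smul_of_mem_rootSpace (hX i) h
  have hrY : ∀ i (h : H), ⁅(h : L), Y i⁆ = -(R.root i h) • Y i := fun i h =>
    lie_eq_smul_of_mem_rootSpace (hY i) h
  have hrootadd : ∀ i j, b.IsPos i → b.IsPos j → ((i.1 : H → ℂ) + (j.1 : H → ℂ)) ≠ 0 := by
    intro i j hi hj h
    apply pos_ne_neg b hi hj
    ext h'
    have := congrFun h h'
    exact eq_neg_of_add_eq_zero_left this
  have kH : ∀ (h : H) i, killingForm ℂ L (X i) h = 0 ∧ killingForm ℂ L (Y i) h = 0 := by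
    intro h i
    have h0 : (h : L) ∈ rootSpace H (0 : H → ℂ) := by
      rw [rootSpace_zero_eq]; exact h.2
    have hi : (i.1 : H → ℂ) ≠ 0 := LieSubalgebra.isNonZero_coe_root i
    constructor
    · exact killingForm_apply_eq_zero_of_mem_rootSpace_of_add_ne_zero ℂ L H (hX i) h0 (by simp)
    · exact killingForm_apply_eq_zero_of_mem_rootSpace_of_add_ne_zero ℂ L H (hY i) h0 (by simp)
  have kXX : ∀ i j, b.IsPos i → b.IsPos j → killingForm ℂ L (X i) (X j) = 0 := fun i j hi hj =>
    killingForm_apply_eq_zero_of_mem_rootSpace_of_add_ne_zero ℂ L H (hX i) (hX j) (hrootadd i j hi hj)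
  have kYY : ∀ i j, b.IsPos i → b.IsPos j → killingForm ℂ L (Y i) (Y j) = 0 := fun i j hi hj =>
    killingForm_apply_eq_zero_of_mem_rootSpace_of_add_ne_zero ℂ L H (hY i) (hY j) (by
      intro h
      apply hrootadd i j hi hj
      rw [← neg_eq_zero, neg_add]; exact h)
  have kXY : ∀ i j, killingForm ℂ L (X i) (Y j) = if i = j then 1 else 0 := by
    intro i j
    split_ifs with h
    · subst h; exact hXY i
    · refine killingForm_apply_eq_zero_of_mem_rootSpace_of_add_ne_zero ℂ L H (hX i) (hY j) ?_
      intro h'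
      apply h
      apply R.root.injective
      ext h''
      have := congrFun h' h''
      exact add_neg_eq_zero.1 this
  have hspan : ∀ S : Submodule ℂ L, (∀ h : H, (h : L) ∈ S) → (∀ i, b.IsPos i → X i ∈ S) →
      (∀ i, b.IsPos i → Y i ∈ S) → S = ⊤ := by
    intro S h0 h1 h2
    refine span_all H S h0 fun α => ?_
    rcases pos_or b α with hα | ⟨j, hj, hαj⟩
    · refine ⟨X α, hX α, ?_, h1 α hα⟩
      intro h
      have := hXY α
      rw [h] at this
      simp at this
    · refine ⟨Y j, ?_, ?_, h2 j hj⟩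
      · have : (α.1 : H → ℂ) = - (j.1 : H → ℂ) := by
          ext h'
          exact LinearMap.congr_fun hαj h'
        rw [this]; exact hY j
      · intro h
        have := hXY j
        rw [h] at this
        simp at this
  let ub := Module.finBasis ℂ H
  let u' : Fin (finrank ℂ H) → H := fun j => t (ub.coord j)
  have ex1 : ∀ h : H, (h : L) = ∑ j, killingForm ℂ L (u' j) h • (ub j : L) := by
    intro h
    have : h = ∑ j, ub.coord j h • ub j := (ub.sum_repr h).symm
    conv_lhs => rw [this]
    simp only [u', htk]
    push_cast
    rfl
  have ex2 : ∀ h : H, (h : L) = ∑ j, killingForm ℂ L (ub j) h • (u' j : L) := by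
    intro h
    have h1 : h = t (cartanEquivDual H h) := ((cartanEquivDual H).symm_apply_apply h).symm
    have h2 : cartanEquivDual H h = ∑ j, killingForm ℂ L (ub j) h • ub.coord j := by
      refine ub.ext fun k => ?_
      simp only [LinearMap.sum_apply, LinearMap.smul_apply, Basis.coord_apply, Basis.repr_self,
        Finsupp.single_apply, smul_eq_mul, mul_ite, mul_one, mul_zero, Finset.sum_ite_eq,
        Finset.mem_univ, if_true]
      rw [hkc]; rfl
    conv_lhs => rw [h1, h2, map_sum]
    simp only [map_smul]
    push_cast
    rfl
  have casE : ∀ z : L, ⁅z, ∑ s : Fin (finrank ℂ H) ⊕ ({i // b.IsPos i} ⊕ {i // b.IsPos i}),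
      (Sum.elim (fun j => (ub j : L)) (Sum.elim (fun i => X i.1) (fun i => Y i.1)) s) ⊗ₜ[ℂ]
      (Sum.elim (fun j => (u' j : L)) (Sum.elim (fun i => Y i.1) (fun i => X i.1)) s)⁆ = 0 := by
    refine casimir_inv (fun x y => killingForm ℂ L x y) ?_ _ _ ?_ ?_
    · intro z x y
      show killingForm ℂ L x ⁅z, y⁆ = - killingForm ℂ L y ⁅z, x⁆
      have h1 := LieModule.traceForm_apply_lie_apply ℂ L L x z y
      have h2 : killingForm ℂ L ⁅x, z⁆ y = killingForm ℂ L x ⁅z, y⁆ := h1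
      rw [← h2, hkc, ← lie_skew, map_neg]
    · intro z
      have : expSub (S := Fin (finrank ℂ H) ⊕ ({i // b.IsPos i} ⊕ {i // b.IsPos i})) (killingForm ℂ L) (Sum.elim (fun j => (u' j : L))
              (Sum.elim (fun i => Y i.1) (fun i => X i.1)))
          (Sum.elim (fun j => (ub j : L)) (Sum.elim (fun i => X i.1) (fun i => Y i.1))) = ⊤ := by
        refine hspan _ ?_ ?_ ?_
        · intro h
          show _ = _
          simp only [Fintype.sum_sum_type, Sum.elim_inl, Sum.elim_inr]
          simp only [(kH h _).1, (kH h _).2, zero_smul, Finset.sum_const_zero, add_zero]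
          exact ex1 h
        · intro i hi
          show _ = _
          simp only [Fintype.sum_sum_type, Sum.elim_inl, Sum.elim_inr]
          have e1 : ∀ j, killingForm ℂ L (u' j) (X i) = 0 := fun j => by rw [hkc]; exact (kH _ i).1
          have e2 : ∀ j : {i // b.IsPos i}, killingForm ℂ L (X j) (X i) = 0 := fun j => kXX _ _ j.2 hi
          have e3 : ∀ j : {i // b.IsPos i}, killingForm ℂ L (Y j) (X i) =
              if (⟨i, hi⟩ : {i // b.IsPos i}) = j then 1 else 0 := fun j => by
            rw [hkc, kXY]; simp only [Subtype.ext_iff]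
          simp only [e1, e2, e3, zero_smul, ite_smul, one_smul, Finset.sum_const_zero, add_zero,
            zero_add, Finset.sum_ite_eq, Finset.mem_univ, if_true]
        · intro i hi
          show _ = _
          simp only [Fintype.sum_sum_type, Sum.elim_inl, Sum.elim_inr]
          have e1 : ∀ j, killingForm ℂ L (u' j) (Y i) = 0 := fun j => by rw [hkc]; exact (kH _ i).2
          have e2 : ∀ j : {i // b.IsPos i}, killingForm ℂ L (Y j) (Y i) = 0 := fun j => kYY _ _ j.2 hi
          have e3 : ∀ j : {i // b.IsPos i}, killingForm ℂ L (X j) (Y i) =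
              if (⟨i, hi⟩ : {i // b.IsPos i}) = j then 1 else 0 := fun j => by
            rw [kXY]; simp only [Subtype.ext_iff, eq_comm]
          simp only [e1, e2, e3, zero_smul, ite_smul, one_smul, Finset.sum_const_zero, add_zero,
            zero_add, Finset.sum_ite_eq, Finset.mem_univ, if_true]
      have h2 : z ∈ (⊤ : Submodule ℂ L) := trivial
      rw [← this] at h2
      exact h2
    · intro z
      have : expSub (S := Fin (finrank ℂ H) ⊕ ({i // b.IsPos i} ⊕ {i // b.IsPos i})) (killingForm ℂ L) (Sum.elim (fun j => (ub j : L))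
              (Sum.elim (fun i => X i.1) (fun i => Y i.1)))
          (Sum.elim (fun j => (u' j : L)) (Sum.elim (fun i => Y i.1) (fun i => X i.1))) = ⊤ := by
        refine hspan _ ?_ ?_ ?_
        · intro h
          show _ = _
          simp only [Fintype.sum_sum_type, Sum.elim_inl, Sum.elim_inr]
          simp only [(kH h _).1, (kH h _).2, zero_smul, Finset.sum_const_zero, add_zero]
          exact ex2 h
        · intro i hi
          show _ = _
          simp only [Fintype.sum_sum_type, Sum.elim_inl, Sum.elim_inr]
          have e1 : ∀ j, killingForm ℂ L (ub j) (X i) = 0 := fun j => by rw [hkc]; exact (kH _ i).1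
          have e2 : ∀ j : {i // b.IsPos i}, killingForm ℂ L (X j) (X i) = 0 := fun j => kXX _ _ j.2 hi
          have e3 : ∀ j : {i // b.IsPos i}, killingForm ℂ L (Y j) (X i) =
              if (⟨i, hi⟩ : {i // b.IsPos i}) = j then 1 else 0 := fun j => by
            rw [hkc, kXY]; simp only [Subtype.ext_iff]
          simp only [e1, e2, e3, zero_smul, ite_smul, one_smul, Finset.sum_const_zero, add_zero,
            zero_add, Finset.sum_ite_eq, Finset.mem_univ, if_true]
        · intro i hi
          show _ = _
          simp only [Fintype.sum_sum_type, Sum.elim_inl, Sum.elim_inr]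
          have e1 : ∀ j, killingForm ℂ L (ub j) (Y i) = 0 := fun j => by rw [hkc]; exact (kH _ i).2
          have e2 : ∀ j : {i // b.IsPos i}, killingForm ℂ L (Y j) (Y i) = 0 := fun j => kYY _ _ j.2 hi
          have e3 : ∀ j : {i // b.IsPos i}, killingForm ℂ L (X j) (Y i) =
              if (⟨i, hi⟩ : {i // b.IsPos i}) = j then 1 else 0 := fun j => by
            rw [kXY]; simp only [Subtype.ext_iff, eq_comm]
          simp only [e1, e2, e3, zero_smul, ite_smul, one_smul, Finset.sum_const_zero, add_zero,
            zero_add, Finset.sum_ite_eq, Finset.mem_univ, if_true]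
      have h2 : z ∈ (⊤ : Submodule ℂ L) := trivial
      rw [← this] at h2
      exact h2
  have sumP : ∀ {Z : Type} [AddCommMonoid Z] (F : Dual ℂ H → Z),
      ∑ α ∈ P, F α = ∑ i : {i // b.IsPos i}, F (R.root i.1) := by
    intro Z _ F
    rw [Finset.sum_image (fun i _ j _ h => R.root.injective h)]
    exact (Finset.sum_subtype _ (by simp) _)
  have hBsq : ∀ μ : Dual ℂ H, μ (t μ) = 2 * ∑ γ ∈ P, (μ (t γ)) ^ 2 := by
    intro μ
    have h1 : μ (t μ) = ∑ i, (R.root i (t μ)) ^ 2 := by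
      rw [← htk μ (t μ)]
      have := restrict_killingForm_eq_sum (K := ℂ) (L := L) (H := H)
      have h2 := LinearMap.congr_fun (LinearMap.congr_fun this (t μ)) (t μ)
      rw [← Finset.sum_coe_sort H.root] at h2
      refine Eq.trans h2 ?_
      simp only [LinearMap.sum_apply]
      refine Finset.sum_congr rfl fun i _ => ?_
      rw [pow_two]; rfl
    rw [h1, sumP, ← Finset.sum_filter_add_sum_filter_not Finset.univ (fun i => b.IsPos i), two_mul]
    congr 1
    · rw [Finset.sum_subtype (p := fun i => b.IsPos i) _ (by simp)]
      exact Finset.sum_congr rfl fun i _ => by rw [htsymm]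
    · symm
      let := R.indexNeg
      have hneg : ∀ i : H.root, R.root (-i) = - R.root i := fun i => by simp
      refine Finset.sum_bij (fun i _ => -i.1) ?_ ?_ ?_ ?_
      · intro i _
        simp only [Finset.mem_filter, Finset.mem_univ, true_and]
        rw [RootPairing.Base.IsPos.neg_iff_not]
        exact not_not.2 i.2
      · intro i _ j _ h
        exact Subtype.ext (neg_injective h)
      · intro j hj
        simp only [Finset.mem_filter, Finset.mem_univ, true_and] at hj
        exact ⟨⟨-j, (RootPairing.Base.IsPos.neg_iff_not b j).2 hj⟩, Finset.mem_univ _, neg_neg j⟩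
      · intro i _
        rw [hneg, htsymm, LinearMap.neg_apply, neg_sq]
  have hne : Nonempty H.root := by
    by_contra hemp
    rw [not_nonempty_iff] at hemp
    have h1 := RootPairing.IsIrreducible.nontrivial (P := R)
    have h2 := RootPairing.IsRootSystem.span_root_eq_top (P := R)
    rw [Set.range_eq_empty, Submodule.span_empty] at h2
    exact bot_ne_top h2
  obtain ⟨v0, hv0⟩ := b.support_nonempty
  have hpair : ∀ i j, R.root i (R.coroot j) = R.pairing i j := fun i j => rfl
  have hroot0 : ∀ i, R.root i (t (R.root i)) ≠ 0 := fun i =>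
    root_apply_cartanEquivDual_symm_ne_zero (LieSubalgebra.isNonZero_coe_root i)
  have hc2 : ∀ i, Cc i * R.root i (t (R.root i)) = 2 := by
    intro i
    have := R.pairing_same i
    rw [← hpair, hcoR, map_smul] at this
    exact this
  have hpz : ∀ i j, R.pairing i j = (R.pairingIn ℤ i j : ℂ) := by
    intro i j
    rw [← R.algebraMap_pairingIn ℤ]; rfl
  refine ⟨{
    a := fun i => R.root i
    hc := fun i => R.coroot i
    A := fun i j => R.pairingIn ℤ i j
    hA := ?hA
    diag := ?diag
    off := ?off
    zero := ?zero
    P := P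
    aP := ?aP
    perm := ?perm
    Pcomb := ?Pcomb
    lin := b.linearIndepOn_root
    sep := ?sep
    B := LinearMap.mk₂ ℂ (fun μ ν => ν (t μ)) (by simp) (by simp) (by simp) (by simp)
    Bsymm := ?Bsymm
    Bref := ?Bref
    Bsq := ?Bsq
    Bne := ?Bne
    J := Fin (finrank ℂ H)
    u := ub
    u' := u'
    hB := ?hB
    t := t
    ht := ?ht
    v0 := ⟨v0, hv0⟩
    conn := ?conn
    em := H.toSubmodule.subtype
    abel := ?abel
    x := x
    y := y
    hx := ?hx
    hy := ?hy
    span := ?span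
    hxy := ?hxy
    c := c
    sl2 := ?sl2
    hc_eq := ?hc_eq
    cas := ?cas
    wtex := ?wtex }⟩
  case hA => intro i j; exact (hpair i j).trans (hpz i j)
  case diag => intro i; exact R.pairingIn_same ℤ i
  case off =>
    intro i j hij
    exact b.pairingIn_le_zero_of_ne (fun h => hij (Subtype.ext h)) i.2 j.2
  case zero =>
    intro i j h
    have h1 : R.pairing i j = 0 := by rw [hpz]; exact_mod_cast h
    have h2 := RootPairing.pairing_eq_zero_iff.1 h1
    rw [hpz] at h2
    exact_mod_cast h2
  case aP => intro i; exact hPm _ (RootPairing.Base.isPos_of_mem_support i.2)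
  case perm =>
    intro i α hα hne
    obtain ⟨j, hj, rfl⟩ := (hP _).1 hα
    have h1 := hj.reflectionPerm i.2 (fun h => hne (by rw [h]))
    have h2 := hPm _ h1
    rw [R.root_reflectionPerm, R.reflection_apply_root] at h2
    exact h2
  case Pcomb =>
    intro α hα
    obtain ⟨j, hj, rfl⟩ := (hP _).1 hα
    exact pos_comb b hj
  case sep =>
    intro μ hμ
    refine b.toCoweightBasis.ext fun i => ?_
    have : b.toCoweightBasis i = R.coroot i := b.toCoweightBasis_apply i
    rw [this, hμ i, LinearMap.zero_apply]
  case Bsymm => intro μ ν; exact htsymm _ _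
  case Bref =>
    intro i μ
    show μ (t (R.root i)) = R.root i (t (R.root i)) / 2 * μ (R.coroot i)
    rw [hcoR, map_smul, smul_eq_mul]
    linear_combination (-(μ (t (R.root i)))/2) * hc2 i
  case Bsq => intro μ; exact hBsq μ
  case Bne => intro i; exact hroot0 i
  case hB =>
    intro μ ν
    show ν (t μ) = ∑ j, μ (ub j) * ν (t (ub.coord j))
    have : μ = ∑ j, μ (ub j) • ub.coord j := by
      refine ub.ext fun k => ?_
      simp
    conv_lhs => rw [this]
    rw [map_sum, map_sum]
    exact Finset.sum_congr rfl fun j _ => by rw [map_smul, map_smul, smul_eq_mul]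
  case ht => intro μ ν; rfl
  case conn => exact base_conn b _ (fun i j => hpz i j) _
  case abel =>
    intro h h'
    have : ⁅h, h'⁆ = 0 := trivial_lie_zero _ _ _ _
    exact congrArg Subtype.val this
  case hx =>
    intro α hα h
    obtain ⟨i, hi, rfl⟩ := (hP _).1 hα
    rw [xe]; exact hrX i h
  case hy =>
    intro α hα h
    obtain ⟨i, hi, rfl⟩ := (hP _).1 hα
    rw [ye]; exact hrY i h
  case span =>
    intro S h0 h1 h2
    refine hspan S h0 (fun i hi => ?_) (fun i hi => ?_)
    · have := h1 _ (hPm i hi); rwa [xe] at this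
    · have := h2 _ (hPm i hi); rwa [ye] at this
  case hxy =>
    intro α hα
    obtain ⟨i, hi, rfl⟩ := (hP _).1 hα
    rw [xe, ye, lie_eq_killingForm_smul_of_mem_rootSpace_of_mem_rootSpace_neg (hX i) (hY i), hXY,
      one_smul]
    rfl
  case sl2 =>
    intro α hα
    obtain ⟨i, hi, rfl⟩ := (hP _).1 hα
    rw [xe, ye, ce]
    exact hsl i
  case hc_eq => intro i; show R.coroot i = c (R.root i) • t (R.root i); rw [ce]; exact hcoR i
  case cas =>
    intro z
    have h1 := casE z
    simp only [Fintype.sum_sum_type, Sum.elim_inl, Sum.elim_inr] at h1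
    rw [sumP, Finset.sum_add_distrib]
    simp only [xe, ye]
    exact h1
  case wtex =>
    intro M _ _ _ _ _ _
    obtain ⟨χ, hχ⟩ := LieModule.exists_nontrivial_weightSpace_of_isNilpotent ℂ H M
    obtain ⟨m, hm⟩ := exists_ne (0 : LieModule.weightSpace M χ)
    refine ⟨χ, m, fun h => hm (Subtype.ext h), fun h => ?_⟩
    exact (LieModule.mem_weightSpace χ (m : M)).1 m.2 h
end Construct2
end UFT


namespace UFT
section Final
open Module
open scoped TensorProduct

variable {L : Type} [LieRing L] [LieAlgebra ℂ L] {H : Type} [AddCommGroup H] [Module ℂ H]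
  {ι : Type} [Fintype ι] [DecidableEq ι]

lemma hasChar_unit (D : RD L H ι) : D.HasChar (LieModuleObj.unit L).carrier 1 := by
  refine ⟨Unit, inferInstance, (Basis.singleton Unit ℂ : Basis Unit ℂ ℂ), fun _ => 0, ⟨?_⟩, ?_⟩
  · intro i h
    rw [LinearMap.zero_apply, zero_smul]
    rfl
  · simp [ex]
    rfl

lemma hasChar_tensorAll (D : RD L H ι) : ∀ (n : ℕ) (V : Fin n → LieModuleObj L)
    (ch : Fin n → GAlg H), (∀ i, D.HasChar (V i).carrier (ch i)) →
    D.HasChar (LieModuleObj.tensorAll n V).carrier (∏ i, ch i)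
  | 0, V, ch, _ => by
    rw [Fin.prod_univ_zero]
    exact hasChar_unit D
  | n + 1, V, ch, h => by
    rw [Fin.prod_univ_castSucc]
    exact RD.HasChar.tensor D (hasChar_tensorAll D n (fun i => V i.castSucc) _ (fun i => h _)) (h _)

lemma factor_data (D : RD L H ι) (M : Type) [AddCommGroup M] [Module ℂ M] [LieRingModule L M]
    [LieModule ℂ L M] [FiniteDimensional ℂ M] (hirr : LieModule.IsIrreducible ℂ L M)
    (hnt : ¬ LieModule.IsTrivial L M) :
    ∃ (l : Dual ℂ H) (v : M) (k : _) (ch : GAlg H), v ≠ 0 ∧ D.HW l v ∧ D.IsChar l k ch ∧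
      D.HasChar M ch ∧ k ≠ 0 := by
  have : Nontrivial M := LieModule.nontrivial_of_isIrreducible ℂ L M
  obtain ⟨l, v, hv, h⟩ := D.exists_hw M
  obtain ⟨k, ch, h1, h2⟩ := D.isChar hirr hv h
  refine ⟨l, v, k, ch, hv, h, h1, h2, ?_⟩
  rintro rfl
  have hl : l = 0 := D.sep l fun i => by rw [h1.wt]; simp
  subst hl
  exact hnt (D.trivial_of_zero hirr hv h)

end Final
end UFT

/-- **Unique factorization of tensor products (nontrivial factors).**
Let `g` be a finite-dimensional simple complex Lie algebra, and let
`V 0, …, V (n-1)` and `W 0, …, W (m-1)` (`n, m ≥ 1`) be nontrivial finite-dimensional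
irreducible `g`-modules with `V 0 ⊗ ⋯ ⊗ V (n-1) ≅ W 0 ⊗ ⋯ ⊗ W (m-1)`.  Then `n = m` and
there is a bijection `σ` with `V i ≅ W (σ i)` for all `i`. -/
theorem unique_factorization_tensor_product_nontrivial
    {L : Type} [LieRing L] [LieAlgebra ℂ L] [FiniteDimensional ℂ L] [LieAlgebra.IsSimple ℂ L]
    (n m : ℕ) (hn : 0 < n) (hm : 0 < m)
    (V : Fin n → LieModuleObj L) (W : Fin m → LieModuleObj L)
    (hVfd : ∀ i, FiniteDimensional ℂ (V i).carrier)
    (hWfd : ∀ j, FiniteDimensional ℂ (W j).carrier)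
    (hVirr : ∀ i, LieModule.IsIrreducible ℂ L (V i).carrier)
    (hWirr : ∀ j, LieModule.IsIrreducible ℂ L (W j).carrier)
    (hVnontriv : ∀ i, ¬ LieModule.IsTrivial L (V i).carrier)
    (hWnontriv : ∀ j, ¬ LieModule.IsTrivial L (W j).carrier)
    (h : Nonempty ((LieModuleObj.tensorAll n V).carrier ≃ₗ⁅ℂ,L⁆
      (LieModuleObj.tensorAll m W).carrier)) :
    n = m ∧ ∃ σ : Fin n ≃ Fin m,
      ∀ i, Nonempty ((V i).carrier ≃ₗ⁅ℂ,L⁆ (W (σ i)).carrier) := by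
  
  classical
  obtain ⟨x, hx⟩ := LieAlgebra.exists_isCartanSubalgebra_engel ℂ L
  obtain ⟨b⟩ := RootPairing.nonempty_base
    (LieAlgebra.IsKilling.rootSystem (LieSubalgebra.engel ℂ x))
  obtain ⟨D⟩ := UFT.exists_RD (LieSubalgebra.engel ℂ x) b
  choose l v k ch hv hw hch hM hk using
    fun i => UFT.factor_data D (V i).carrier (hVirr i) (hVnontriv i)
  choose l' v' k' ch' hv' hw' hch' hM' hk' using
    fun i => UFT.factor_data D (W i).carrier (hWirr i) (hWnontriv i)
  obtain ⟨e⟩ := h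
  have h1 := UFT.RD.HasChar.map D (UFT.hasChar_tensorAll D n V ch hM) e
  have heq := UFT.RD.HasChar.unique D h1 (UFT.hasChar_tensorAll D m W ch' hM')
  obtain ⟨σ, hσ⟩ := UFT.chars_unique D.toCD l l' k k' ch ch' hch hch' hk hk' heq
  refine ⟨by simpa using Fintype.card_congr σ, σ, fun i => ?_⟩
  have hl : l i = l' (σ i) := by
    rw [← sub_eq_zero]
    refine D.sep _ fun j => ?_
    rw [LinearMap.sub_apply, (hch i).wt, (hch' (σ i)).wt, hσ i, sub_self]
  have hw2 := hw i
  rw [hl] at hw2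
  exact UFT.RD.iso_of_hw D (hVirr i) (hWirr (σ i)) (hv i) (hv' (σ i)) hw2 (hw' (σ i))
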